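/- arXiv:math/0501209 — 5 statements merged into one kernel-verified Lean document; each statement's English description precedes it below -/
import Mathlib

section
/- Let K be a field of characteristic p > 0, q = p^n, and R = K[X,Y,U,V]/(XY − UV). Let F^n(K) = R/(x^q, y^q, u^q, v^q). Then the length of Tor_3^R(F^n(K), R/(x, y, u+v)) is at least p^n. -/
open CategoryTheory MvPolynomial

/-- Length of a module, as the Krull dimension of its lattice of submodules. -/
noncomputable def moduleLength (R M : Type*) [Ring R] [AddCommGroup M] [Module R M] :
    WithBot ℕ∞ := Order.krullDim (Submodule R M)

/-- `Tor_n^R(M, N)` as a module category object. -/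
noncomputable abbrev torMod (R : Type) [CommRing R] (n : ℕ)
    (M N : Type) [AddCommGroup M] [Module R M] [AddCommGroup N] [Module R N] : ModuleCat R :=
  ((Tor (ModuleCat R) n).obj (ModuleCat.of R M)).obj (ModuleCat.of R N)

/-- `R = K[X,Y,U,V]/(XY - UV)`. -/
noncomputable abbrev hypersurfaceRing (K : Type) [Field K] : Type :=
  MvPolynomial (Fin 4) K ⧸
    Ideal.span {(X 0 : MvPolynomial (Fin 4) K) * X 1 - X 2 * X 3}

/-- The `n`-th Frobenius power `F^n(K) = R/(x^q, y^q, u^q, v^q)` of the residue field. -/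
noncomputable abbrev frobPower (K : Type) [Field K] (q : ℕ) : Type :=
  hypersurfaceRing K ⧸
    Ideal.span ({Ideal.Quotient.mk _ (X 0) ^ q, Ideal.Quotient.mk _ (X 1) ^ q,
      Ideal.Quotient.mk _ (X 2) ^ q, Ideal.Quotient.mk _ (X 3) ^ q} :
        Set (hypersurfaceRing K))

namespace KosTor

variable {R : Type} [CommRing R] (x y z : R)

/-- Third Koszul differential. -/
def d3 : R →ₗ[R] R × R × R :=
  (LinearMap.lsmul R R z).prod ((-(LinearMap.lsmul R R y)).prod (LinearMap.lsmul R R x))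

/-- Second Koszul differential. -/
def d2 : R × R × R →ₗ[R] R × R × R where
  toFun a := (-(y * a.1) - z * a.2.1, x * a.1 - z * a.2.2, x * a.2.1 + y * a.2.2)
  map_add' a b := by ext <;> simp <;> ring
  map_smul' a b := by ext <;> simp <;> ring

/-- First Koszul differential. -/
def d1 : R × R × R →ₗ[R] R where
  toFun a := x * a.1 + y * a.2.1 + z * a.2.2
  map_add' a b := by simp; ring
  map_smul' a b := by simp; ring

/-- Objects of the Koszul complex. -/
def kX (R : Type) [CommRing R] : ℕ → ModuleCat.{0} R
  | 0 => ModuleCat.of R R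
  | 1 => ModuleCat.of R (R × R × R)
  | 2 => ModuleCat.of R (R × R × R)
  | 3 => ModuleCat.of R R
  | _ + 4 => ModuleCat.of R PUnit

/-- Differentials of the Koszul complex. -/
def kd : (n : ℕ) → (kX R (n + 1) ⟶ kX R n)
  | 0 => ModuleCat.ofHom (d1 x y z)
  | 1 => ModuleCat.ofHom (d2 x y z)
  | 2 => ModuleCat.ofHom (d3 x y z)
  | _ + 3 => 0

lemma kd_sq : ∀ n, kd x y z (n + 1) ≫ kd x y z n = 0
  | 0 => by
    apply ModuleCat.hom_ext
    apply LinearMap.ext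
    intro a
    change d1 x y z (d2 x y z a) = 0
    simp [d1, d2]; ring
  | 1 => by
    apply ModuleCat.hom_ext
    apply LinearMap.ext
    intro (a : R)
    change d2 x y z (d3 x y z a) = 0
    ext <;> simp [d2, d3] <;> ring
  | 2 => Limits.zero_comp
  | _ + 3 => Limits.zero_comp

/-- The Koszul complex. -/
noncomputable def kC : ChainComplex (ModuleCat.{0} R) ℕ :=
  ChainComplex.of (kX R) (kd x y z) (kd_sq x y z)

lemma kC_d (n : ℕ) : (kC x y z).d (n + 1) n = kd x y z n := ChainComplex.of_d _ _ _

lemma kC_proj : ∀ n, Projective ((kC x y z).X n)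
  | 0 => (IsProjective.iff_projective _).1 (inferInstanceAs (Module.Projective R R))
  | 1 => (IsProjective.iff_projective _).1 (inferInstanceAs (Module.Projective R (R × R × R)))
  | 2 => (IsProjective.iff_projective _).1 (inferInstanceAs (Module.Projective R (R × R × R)))
  | 3 => (IsProjective.iff_projective _).1 (inferInstanceAs (Module.Projective R R))
  | _ + 4 => (IsProjective.iff_projective _).1 (inferInstanceAs (Module.Projective R PUnit))

/-- The augmentation. -/
noncomputable def aug : kX R 0 ⟶ ModuleCat.of R (R ⧸ Ideal.span {x, y, z}) :=
  ModuleCat.ofHom (Submodule.mkQ (Ideal.span {x, y, z}))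

lemma mem3 (a : R) : a ∈ Ideal.span {x, y, z} ↔ ∃ b : R × R × R, d1 x y z b = a := by
  simp only [Ideal.mem_span_insert, Ideal.mem_span_singleton']
  constructor
  · rintro ⟨b, w, ⟨c, w', ⟨d, rfl⟩, rfl⟩, rfl⟩
    exact ⟨(b, c, d), by simp [d1]; ring⟩
  · rintro ⟨⟨b, c, d⟩, rfl⟩
    exact ⟨b, c * y + d * z, ⟨c, d * z, ⟨d, rfl⟩, rfl⟩, by simp [d1]; ring⟩

lemma kd_aug : (kC x y z).d 1 0 ≫ aug x y z = 0 := by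
  rw [kC_d]
  apply ModuleCat.hom_ext
  apply LinearMap.ext
  intro a
  change Submodule.mkQ (Ideal.span {x, y, z}) (d1 x y z a) = 0
  rw [Submodule.mkQ_apply, Submodule.Quotient.mk_eq_zero, mem3]
  exact ⟨a, rfl⟩

variable {x y z}

lemma kC_exact (h1 : ∀ a, x * a = 0 → a = 0)
    (h2 : ∀ a b, y * a = x * b → ∃ c, a = x * c)
    (h3 : ∀ a b c, z * a = x * b + y * c → ∃ d e, a = x * d + y * e) :
    ∀ n, (ShortComplex.mk _ _ (kd_sq x y z n)).Exact
  | 0 => by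
    rw [ShortComplex.moduleCat_exact_iff]
    rintro ⟨a, b, c⟩ h
    change x * a + y * b + z * c = 0 at h
    obtain ⟨s, t, hc⟩ := h3 c (-a) (-b) (by linear_combination h)
    obtain ⟨w, hw⟩ := h2 (b + z * t) (-(a + z * s)) (by subst hc; linear_combination h)
    have := h1 (a + z * s + y * w) (by subst hc; linear_combination h - y * hw)
    refine ⟨((w, s, t) : R × R × R), ?_⟩
    change d2 x y z (w, s, t) = (a, b, c)
    ext
    · simp [d2]; linear_combination -this
    · simp [d2]; linear_combination -hw
    · simp [d2]; linear_combination -hc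
  | 1 => by
    rw [ShortComplex.moduleCat_exact_iff]
    rintro ⟨a, b, c⟩ h
    change ((-(y * a) - z * b, x * a - z * c, x * b + y * c) : R × R × R) = 0 at h
    simp only [Prod.ext_iff, Prod.fst_zero, Prod.snd_zero] at h
    obtain ⟨e1, e2, e3⟩ := h
    obtain ⟨r, hr⟩ := h2 c (-b) (by linear_combination e3)
    have hb := h1 (b + y * r) (by subst hr; linear_combination e3)
    have ha := h1 (a - z * r) (by subst hr; linear_combination e2)
    refine ⟨(r : R), ?_⟩
    change d3 x y z r = (a, b, c)
    ext
    · simp [d3]; linear_combination -ha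
    · simp [d3]; linear_combination -hb
    · simp [d3]; linear_combination -hr
  | 2 => by
    rw [ShortComplex.moduleCat_exact_iff]
    intro (a : R) h
    change ((z * a, -(y * a), x * a) : R × R × R) = 0 at h
    simp only [Prod.ext_iff, Prod.fst_zero, Prod.snd_zero] at h
    refine ⟨PUnit.unit, ?_⟩
    exact (h1 _ h.2.2).symm
  | n + 3 => by
    rw [ShortComplex.moduleCat_exact_iff]
    intro a h
    exact ⟨PUnit.unit, rfl⟩

/-- The Koszul resolution. -/
noncomputable def kRes (h1 : ∀ a, x * a = 0 → a = 0)
    (h2 : ∀ a b, y * a = x * b → ∃ c, a = x * c)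
    (h3 : ∀ a b c, z * a = x * b + y * c → ∃ d e, a = x * d + y * e) :
    ProjectiveResolution (ModuleCat.of R (R ⧸ Ideal.span {x, y, z})) where
  complex := kC x y z
  projective := kC_proj x y z
  π := (ChainComplex.toSingle₀Equiv _ _).symm ⟨aug x y z, kd_aug x y z⟩
  quasiIso := ⟨fun n => by
    cases n with
    | zero =>
      rw [ChainComplex.quasiIsoAt₀_iff, ShortComplex.quasiIso_iff_of_zeros' _ rfl rfl rfl]
      constructor
      · rw [ShortComplex.moduleCat_exact_iff]
        intro (a : R) h
        have h' : Submodule.mkQ (Ideal.span {x, y, z}) a = 0 := h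
        rw [Submodule.mkQ_apply, Submodule.Quotient.mk_eq_zero, mem3] at h'
        obtain ⟨b, hb⟩ := h'
        refine ⟨b, ?_⟩
        change (kC x y z).d 1 0 b = a
        rw [kC_d]
        exact hb
      · rw [ModuleCat.epi_iff_surjective]
        exact Submodule.mkQ_surjective (Ideal.span {x, y, z})
    | succ n =>
      rw [quasiIsoAt_iff_exactAt' (hL := ChainComplex.exactAt_succ_single_obj ..),
          HomologicalComplex.exactAt_iff' _ (n + 2) (n + 1) n (by simp) (by simp)]
      have := kC_exact h1 h2 h3 n
      refine (ShortComplex.exact_iff_of_iso ?_).1 this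
      exact ShortComplex.isoMk (Iso.refl _) (Iso.refl _) (Iso.refl _)
          (by simp [kC_d]; exact (Category.id_comp _).trans (Category.comp_id _).symm)
          (by simp [kC_d]; exact (Category.id_comp _).trans (Category.comp_id _).symm)⟩

open TensorProduct in
theorem length_le_tor (h1 : ∀ a, x * a = 0 → a = 0)
    (h2 : ∀ a b, y * a = x * b → ∃ c, a = x * c)
    (h3 : ∀ a b c, z * a = x * b + y * c → ∃ d e, a = x * d + y * e)
    (M : Type) [AddCommGroup M] [Module R M] (W : Submodule R M)
    (hW : ∀ m ∈ W, x • m = 0 ∧ y • m = 0 ∧ z • m = 0) :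
    Module.length R W ≤ Module.length R (torMod R 3 M (R ⧸ Ideal.span {x, y, z})) := by
  let F := (MonoidalCategory.tensoringLeft (ModuleCat R)).obj (ModuleCat.of R M)
  let P := kRes h1 h2 h3
  let L := (F.mapHomologicalComplex (ComplexShape.down ℕ)).obj P.complex
  let e : torMod R 3 M (R ⧸ Ideal.span {x, y, z}) ≅ L.homology 3 := P.isoLeftDerivedObj F 3
  let f : W →ₗ[R] M ⊗[R] R := (TensorProduct.rid R M).symm.toLinearMap ∘ₗ W.subtype
  let k : ModuleCat.of R W ⟶ L.X 3 := ModuleCat.ofHom f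
  have hk : k ≫ L.d 3 2 = 0 := by
    have : L.d 3 2 = F.map (kd x y z 2) := by
      rw [← kC_d]; rfl
    rw [this]
    apply ModuleCat.hom_ext
    apply LinearMap.ext
    intro w
    change (d3 x y z).lTensor M ((w : M) ⊗ₜ[R] (1 : R)) = 0
    obtain ⟨a, b, c⟩ := hW w w.2
    have : d3 x y z 1 = z • (1, 0, 0) + y • (0, -1, 0) + x • (0, 0, 1) := by
      ext <;> simp [d3]
    rw [LinearMap.lTensor_tmul, this, TensorProduct.tmul_add, TensorProduct.tmul_add,
      ← TensorProduct.smul_tmul, ← TensorProduct.smul_tmul, ← TensorProduct.smul_tmul, a, b, c]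
    simp
  have hd : L.d 4 3 = 0 := by
    have : L.d 4 3 = F.map (kd x y z 3) := by
      rw [← kC_d]; rfl
    rw [this]
    exact F.map_zero _ _
  have hkm : Mono k := by
    rw [ModuleCat.mono_iff_injective]
    exact (TensorProduct.rid R M).symm.injective.comp W.injective_subtype
  let l := L.liftCycles k 2 (by simp) hk
  have hl : Mono l := by
    have : Mono (l ≫ L.iCycles 3) := by
      rw [HomologicalComplex.liftCycles_i]; exact hkm
    exact mono_of_mono l (L.iCycles 3)
  have hi : IsIso (L.homologyπ 3) := L.isIso_homologyπ 4 3 (by simp) hd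
  let g := l ≫ L.homologyπ 3 ≫ e.inv
  have hg : Mono g := by
    have := hl
    infer_instance
  rw [ModuleCat.mono_iff_injective] at hg
  exact Module.length_le_of_injective g.hom hg

end KosTor
namespace KosTor

section reg
variable {K : Type} [Field K]

lemma not_dvd_X {i j : Fin 4} (h : i ≠ j) :
    ¬ (X i : MvPolynomial (Fin 4) K) ∣ X j := by
  rw [X_dvd_X]; exact h

/-- Setting the variable `i` to zero. -/
noncomputable def kill (i : Fin 4) : MvPolynomial (Fin 4) K →ₐ[K] MvPolynomial (Fin 4) K :=
  aeval (fun j => if j = i then 0 else X j)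

lemma kill_X_self (i : Fin 4) : kill i (X i : MvPolynomial (Fin 4) K) = 0 := by simp [kill]
lemma kill_X_ne {i j : Fin 4} (h : j ≠ i) : kill i (X j : MvPolynomial (Fin 4) K) = X j := by
  simp [kill, h]

lemma kill_sub (i : Fin 4) (a : MvPolynomial (Fin 4) K) : ∃ c, a = kill i a + X i * c := by
  induction a using MvPolynomial.induction_on with
  | C r => exact ⟨0, by simp [kill]⟩
  | add a b ha hb =>
    obtain ⟨c, hc⟩ := ha
    obtain ⟨d, hd⟩ := hb
    exact ⟨c + d, by rw [map_add]; linear_combination hc + hd⟩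
  | mul_X a j ha =>
    obtain ⟨c, hc⟩ := ha
    by_cases h : j = i
    · subst h
      exact ⟨a, by rw [map_mul, kill_X_self]; ring⟩
    · exact ⟨c * X j, by rw [map_mul, kill_X_ne h]; linear_combination (X j) * hc⟩

local notation "π" => Ideal.Quotient.mk (Ideal.span {(X 0 : MvPolynomial (Fin 4) K) * X 1 - X 2 * X 3})

lemma mk_eq_iff (a b : MvPolynomial (Fin 4) K) :
    π a = π b ↔ ∃ c, a - b = (X 0 * X 1 - X 2 * X 3) * c := by
  rw [Ideal.Quotient.eq, Ideal.mem_span_singleton]; rfl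

lemma reg1 (a : hypersurfaceRing K) (h : π (X 0) * a = 0) : a = 0 := by
  obtain ⟨a, rfl⟩ := Ideal.Quotient.mk_surjective a
  rw [← map_mul, ← map_zero π, mk_eq_iff] at h
  obtain ⟨c, hc⟩ := h
  have : (X 0 : MvPolynomial (Fin 4) K) ∣ X 2 * (X 3 * c) := ⟨X 1 * c - a, by linear_combination hc⟩
  rw [X_prime.dvd_mul, X_prime.dvd_mul] at this
  obtain ⟨d, rfl⟩ := (this.resolve_left (not_dvd_X (by decide))).resolve_left
    (not_dvd_X (by decide))
  rw [← map_zero π, mk_eq_iff]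
  refine ⟨d, mul_left_cancel₀ (X_ne_zero 0) ?_⟩
  linear_combination hc

lemma reg2 (a b : hypersurfaceRing K) (h : π (X 1) * a = π (X 0) * b) :
    ∃ c, a = π (X 0) * c := by
  obtain ⟨a, rfl⟩ := Ideal.Quotient.mk_surjective a
  obtain ⟨b, rfl⟩ := Ideal.Quotient.mk_surjective b
  rw [← map_mul, ← map_mul, mk_eq_iff] at h
  obtain ⟨c, hc⟩ := h
  apply_fun kill 0 at hc
  simp only [map_mul, map_sub, kill_X_self, kill_X_ne (show (1 : Fin 4) ≠ 0 by decide),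
    kill_X_ne (show (2 : Fin 4) ≠ 0 by decide), kill_X_ne (show (3 : Fin 4) ≠ 0 by decide)] at hc
  have : (X 1 : MvPolynomial (Fin 4) K) ∣ X 2 * (X 3 * kill 0 c) :=
    ⟨- kill 0 a, by linear_combination hc⟩
  rw [X_prime.dvd_mul, X_prime.dvd_mul] at this
  obtain ⟨d, hd⟩ := (this.resolve_left (not_dvd_X (by decide))).resolve_left
    (not_dvd_X (by decide))
  obtain ⟨e, he⟩ := kill_sub 0 a
  have h0 : kill 0 a = - (X 2 * X 3 * d) := by
    apply mul_left_cancel₀ (X_ne_zero (R := K) (1 : Fin 4))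
    rw [hd] at hc
    linear_combination hc
  refine ⟨π (e - X 1 * d), ?_⟩
  rw [← map_mul, mk_eq_iff]
  exact ⟨d, by linear_combination he + h0⟩

lemma reg3 (a b c : hypersurfaceRing K)
    (h : (π (X 2) + π (X 3)) * a = π (X 0) * b + π (X 1) * c) :
    ∃ d e, a = π (X 0) * d + π (X 1) * e := by
  obtain ⟨a, rfl⟩ := Ideal.Quotient.mk_surjective a
  obtain ⟨b, rfl⟩ := Ideal.Quotient.mk_surjective b
  obtain ⟨c, rfl⟩ := Ideal.Quotient.mk_surjective c
  rw [← map_mul, ← map_mul, ← map_add, ← map_add, ← map_mul, mk_eq_iff] at h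
  obtain ⟨g, hc⟩ := h
  apply_fun kill 0 at hc
  simp only [map_mul, map_sub, map_add, kill_X_self, kill_X_ne (show (1 : Fin 4) ≠ 0 by decide),
    kill_X_ne (show (2 : Fin 4) ≠ 0 by decide), kill_X_ne (show (3 : Fin 4) ≠ 0 by decide)] at hc
  apply_fun kill 1 at hc
  simp only [map_mul, map_sub, map_add, map_zero, kill_X_self,
    kill_X_ne (show (2 : Fin 4) ≠ 1 by decide), kill_X_ne (show (3 : Fin 4) ≠ 1 by decide)] at hc
  obtain ⟨e, he⟩ := kill_sub 0 a
  obtain ⟨f, hf⟩ := kill_sub 1 (kill 0 a)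
  generalize kill 1 (kill 0 a) = a0 at *
  generalize kill 1 (kill 0 g) = g0 at *
  have h2 : (X 2 : MvPolynomial (Fin 4) K) ∣ X 3 * a0 := ⟨-(a0 + X 3 * g0), by linear_combination hc⟩
  have h3 : (X 3 : MvPolynomial (Fin 4) K) ∣ X 2 * a0 := ⟨-(a0 + X 2 * g0), by linear_combination hc⟩
  rw [X_prime.dvd_mul] at h2 h3
  obtain ⟨s, rfl⟩ := h2.resolve_left (not_dvd_X (by decide))
  have h4 := h3.resolve_left (not_dvd_X (by decide))
  rw [X_prime.dvd_mul] at h4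
  obtain ⟨t, rfl⟩ := h4.resolve_left (not_dvd_X (by decide))
  refine ⟨π (e + X 1 * t), π f, ?_⟩
  rw [← map_mul, ← map_mul, ← map_add, mk_eq_iff]
  exact ⟨-t, by linear_combination he + hf⟩

/-- The projection. -/
noncomputable def rho (K : Type) [Field K] (q : ℕ) : hypersurfaceRing K →+* frobPower K q :=
  Ideal.Quotient.mk _

/-- The elements `x^i u^(q-1) v^(q-1-i)`. -/
noncomputable def alpha (K : Type) [Field K] (q i : ℕ) : frobPower K q :=
  rho K q (Ideal.Quotient.mk _ (X 0)) ^ i * rho K q (Ideal.Quotient.mk _ (X 2)) ^ (q - 1) *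
    rho K q (Ideal.Quotient.mk _ (X 3)) ^ (q - 1 - i)

lemma socle_aux {A : Type} [CommRing A] (x y u v : A) (q i : ℕ) (hi : i < q)
    (hxy : x * y = u * v) (hx : x ^ q = 0) (hy : y ^ q = 0) (hu : u ^ q = 0) (hv : v ^ q = 0) :
    x * (x ^ i * u ^ (q - 1) * v ^ (q - 1 - i)) = 0 ∧
    y * (x ^ i * u ^ (q - 1) * v ^ (q - 1 - i)) = 0 ∧
    (u + v) * (x ^ i * u ^ (q - 1) * v ^ (q - 1 - i)) = 0 := by
  obtain ⟨m, rfl⟩ : ∃ m, q = m + i + 1 := ⟨q - 1 - i, by omega⟩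
  have e1 : m + i + 1 - 1 = m + i := rfl
  have e2 : m + i - i = m := by omega
  rw [e1, e2]
  have hm : u ^ m * v ^ m = x ^ m * y ^ m := by rw [← mul_pow, ← mul_pow, hxy]
  have hm1 : u ^ (m + 1) * v ^ (m + 1) = x ^ (m + 1) * y ^ (m + 1) := by
    rw [← mul_pow, ← mul_pow, hxy]
  refine ⟨?_, ?_, ?_⟩
  · linear_combination x ^ (i + 1) * u ^ i * hm + u ^ i * y ^ m * hx
  · cases i with
    | zero => linear_combination y * hm + x ^ m * hy
    | succ j => linear_combination x ^ j * u ^ (m + j + 1) * v ^ m * hxy + x ^ j * v ^ (m + 1) * hu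
  · have : v * (x ^ i * u ^ (m + i) * v ^ m) = 0 := by
      cases i with
      | zero => linear_combination u ^ m * hv
      | succ j => linear_combination x ^ (j + 1) * u ^ j * hm1 + u ^ j * y ^ (m + 1) * hx
    linear_combination this + x ^ i * v ^ m * hu

lemma smul_aux {R : Type} [CommRing R] (I : Ideal R) (r : R) (a : R ⧸ I) :
    r • a = Ideal.Quotient.mk I r * a := Algebra.smul_def r a

set_option maxHeartbeats 1000000 in
lemma alpha_socle (q i : ℕ) (hi : i < q) :
    π (X 0) • alpha K q i = 0 ∧ π (X 1) • alpha K q i = 0 ∧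
      (π (X 2) + π (X 3)) • alpha K q i = 0 := by
  have key := socle_aux ((rho K q) (π (X 0))) ((rho K q) (π (X 1))) ((rho K q) (π (X 2))) ((rho K q) (π (X 3))) q i hi
    (by
      rw [← map_mul, ← map_mul, ← map_mul, ← map_mul]
      congr 1
      rw [mk_eq_iff]
      exact ⟨1, by ring⟩)
    (by rw [← map_pow]; exact Ideal.Quotient.eq_zero_iff_mem.2 (Ideal.subset_span (by simp)))
    (by rw [← map_pow]; exact Ideal.Quotient.eq_zero_iff_mem.2 (Ideal.subset_span (by simp)))
    (by rw [← map_pow]; exact Ideal.Quotient.eq_zero_iff_mem.2 (Ideal.subset_span (by simp)))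
    (by rw [← map_pow]; exact Ideal.Quotient.eq_zero_iff_mem.2 (Ideal.subset_span (by simp)))
  have hs : ∀ r : hypersurfaceRing K, r • alpha K q i = (rho K q) r * alpha K q i :=
    fun r => smul_aux _ r _
  rw [hs, hs, hs, map_add (rho K q), alpha]
  exact key

/-- Monomial ideal used to separate the elements `alpha`. -/
noncomputable def J (K : Type) [Field K] (q k : ℕ) : Ideal (MvPolynomial (Fin 4) K) :=
  Ideal.span {X 2 ^ q, X 3 ^ q, X 1 ^ (q - k)}

/-- Parametrisation of the cone. -/
noncomputable def par : MvPolynomial (Fin 4) K →ₐ[K] MvPolynomial (Fin 4) K :=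
  aeval ![X 0 * X 2, X 1 * X 3, X 0 * X 3, X 1 * X 2]

/-- The induced map from the Frobenius power. -/
noncomputable def sep (K : Type) [Field K] (q k : ℕ) :
    frobPower K q →+* MvPolynomial (Fin 4) K ⧸ J K q k :=
  Ideal.Quotient.lift _ (Ideal.Quotient.lift _
    ((Ideal.Quotient.mk (J K q k)).comp (par (K := K)).toRingHom) (by
      intro a ha
      rw [Ideal.mem_span_singleton] at ha
      obtain ⟨c, rfl⟩ := ha
      have : par ((X 0 : MvPolynomial (Fin 4) K) * X 1 - X 2 * X 3) = 0 := by
        simp [par]; ring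
      simp only [AlgHom.toRingHom_eq_coe, RingHom.comp_apply, RingHom.coe_coe, map_mul (par), this]
      simp)) (by
    intro a ha
    have h2 : Ideal.Quotient.mk (J K q k) (X 2) ^ q = 0 := by
      rw [← map_pow]; exact Ideal.Quotient.eq_zero_iff_mem.2 (Ideal.subset_span (by simp))
    have h3 : Ideal.Quotient.mk (J K q k) (X 3) ^ q = 0 := by
      rw [← map_pow]; exact Ideal.Quotient.eq_zero_iff_mem.2 (Ideal.subset_span (by simp))
    rw [← RingHom.mem_ker]
    refine (Ideal.span_le.2 ?_ : Ideal.span _ ≤ _) ha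
    rintro _ (rfl | rfl | rfl | rfl) <;>
      simp [RingHom.mem_ker, par, mul_pow, h2, h3])

lemma sep_alpha (q k i : ℕ) : sep K q k (alpha K q i) = Ideal.Quotient.mk (J K q k)
    ((X 0 * X 2) ^ i * (X 0 * X 3) ^ (q - 1) * (X 1 * X 2) ^ (q - 1 - i)) := by
  simp [sep, alpha, rho, par]

lemma sep_lt (q k i : ℕ) (hi : i < k) (hk : k < q) : sep K q k (alpha K q i) = 0 := by
  rw [sep_alpha, Ideal.Quotient.eq_zero_iff_mem]
  have : (X 1 : MvPolynomial (Fin 4) K) ^ (q - k) ∈ J K q k := Ideal.subset_span (by simp)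
  refine Ideal.mem_of_dvd _ (Dvd.dvd.mul_left ?_ _) this
  rw [mul_pow]
  exact Dvd.dvd.mul_right (pow_dvd_pow _ (by omega)) _

lemma sep_self (q k : ℕ) (hk : k < q) : sep K q k (alpha K q k) ≠ 0 := by
  rw [sep_alpha, Ne, Ideal.Quotient.eq_zero_iff_mem]
  have hJ : J K q k = Ideal.span ((fun s => monomial s (1 : K)) ''
      {Finsupp.single 2 q, Finsupp.single 3 q, Finsupp.single 1 (q - k)}) := by
    simp [J, Set.image_insert_eq, X_pow_eq_monomial]
  let s : Fin 4 →₀ ℕ := Finsupp.single 0 (q - 1 + k) + Finsupp.single 1 (q - 1 - k) +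
    Finsupp.single 2 (q - 1) + Finsupp.single 3 (q - 1)
  have hm : ((X 0 * X 2) ^ k * (X 0 * X 3) ^ (q - 1) * (X 1 * X 2) ^ (q - 1 - k) :
      MvPolynomial (Fin 4) K) = monomial s 1 := by
    obtain ⟨m, rfl⟩ : ∃ m, q = m + k + 1 := ⟨q - 1 - k, by omega⟩
    have e1 : m + k + 1 - 1 = m + k := rfl
    have e2 : m + k - k = m := by omega
    have : (monomial s (1 : K)) = X 0 ^ (m + k + k) * X 1 ^ m * X 2 ^ (m + k) * X 3 ^ (m + k) := by
      simp only [s, X_pow_eq_monomial, monomial_mul, e1, e2, mul_one]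
    rw [this, e1, e2]
    ring
  rw [hm, hJ, mem_ideal_span_monomial_image]
  intro h
  obtain ⟨t, ht, hle⟩ := h s (by simp)
  rcases ht with rfl | rfl | rfl
  · have := hle 2
    simp [s] at this; omega
  · have := hle 3
    simp [s] at this; omega
  · have := hle 1
    simp [s] at this; omega

lemma alpha_not_mem (q k : ℕ) (hk : k < q) :
    alpha K q k ∉ Submodule.span (hypersurfaceRing K) (alpha K q '' Set.Iio k) := by
  intro h
  apply sep_self (K := K) q k hk
  generalize alpha K q k = b at h
  induction h using Submodule.span_induction with
  | mem a ha =>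
    obtain ⟨i, hi, rfl⟩ := ha
    exact sep_lt q k i hi hk
  | zero => exact map_zero _
  | add a b _ _ ha hb => rw [map_add, ha, hb, add_zero]
  | smul r a _ ha => rw [smul_aux, map_mul, ha, mul_zero]

end reg

lemma le_length {R M : Type} [CommRing R] [AddCommGroup M] [Module R M] (W : Submodule R M)
    (q : ℕ) (w : ℕ → M) (hw : ∀ i < q, w i ∈ W)
    (h : ∀ k < q, w k ∉ Submodule.span R (w '' Set.Iio k)) :
    (q : ℕ∞) ≤ Module.length R W := by
  let s : ℕ → Submodule R W := fun k => (Submodule.span R (w '' Set.Iio k)).comap W.subtype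
  have hs : ∀ k < q, s k < s (k + 1) := by
    intro k hk
    refine lt_of_le_of_ne (Submodule.comap_mono (Submodule.span_mono (Set.image_mono
      (Set.Iio_subset_Iio (Nat.le_succ k))))) ?_
    intro he
    have : (⟨w k, hw k hk⟩ : W) ∈ s (k + 1) := by
      change w k ∈ Submodule.span R (w '' Set.Iio (k + 1))
      exact Submodule.subset_span ⟨k, Nat.lt_succ_self k, rfl⟩
    rw [← he] at this
    exact h k hk this
  let L : LTSeries (Submodule R W) :=
    { length := q
      toFun := fun i => s i
      step := fun i => hs i i.2 }
  have := Order.LTSeries.length_le_krullDim L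
  rw [← Module.coe_length] at this
  exact_mod_cast this

end KosTor

/-- For `R = K[X,Y,U,V]/(XY-UV)` and `q = p^n`,
`ℓ(Tor_3^R(F^n(K), R/(x, y, u+v))) ≥ p^n`. -/
theorem length_tor_three_ge
    (K : Type) [Field K] (p : ℕ) [CharP K p] (hp : 0 < p) (n : ℕ)
    (q : ℕ) (hq : q = p ^ n)
    (x y u v : hypersurfaceRing K)
    (hx : x = Ideal.Quotient.mk _ (X 0)) (hy : y = Ideal.Quotient.mk _ (X 1))
    (hu : u = Ideal.Quotient.mk _ (X 2)) (hv : v = Ideal.Quotient.mk _ (X 3)) :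
    ((q : ℕ∞) : WithBot ℕ∞) ≤
      moduleLength (hypersurfaceRing K)
        (torMod (hypersurfaceRing K) 3 (frobPower K q)
          (hypersurfaceRing K ⧸ Ideal.span {x, y, u + v})) := by
  subst hx hy hu hv
  let W : Submodule (hypersurfaceRing K) (frobPower K q) :=
    Submodule.span _ (KosTor.alpha K q '' Set.Iio q)
  have h1 : (q : ℕ∞) ≤ Module.length (hypersurfaceRing K) W :=
    KosTor.le_length W q (KosTor.alpha K q) (fun i hi => Submodule.subset_span ⟨i, hi, rfl⟩)
      (fun k hk => KosTor.alpha_not_mem q k hk)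
  have h2 := KosTor.length_le_tor KosTor.reg1 KosTor.reg2 KosTor.reg3 (frobPower K q) W (by
    intro m hm
    induction hm using Submodule.span_induction with
    | mem a ha =>
      obtain ⟨i, hi, rfl⟩ := ha
      exact KosTor.alpha_socle q i hi
    | zero => exact ⟨smul_zero _, smul_zero _, smul_zero _⟩
    | add a b _ _ ha hb =>
      refine ⟨?_, ?_, ?_⟩
      · rw [smul_add, ha.1, hb.1, add_zero]
      · rw [smul_add, ha.2.1, hb.2.1, add_zero]
      · rw [smul_add, ha.2.2, hb.2.2, add_zero]
    | smul r a _ ha =>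
      refine ⟨?_, ?_, ?_⟩
      · rw [smul_comm, ha.1, smul_zero]
      · rw [smul_comm, ha.2.1, smul_zero]
      · rw [smul_comm, ha.2.2, smul_zero])
  unfold moduleLength
  rw [← Module.coe_length]
  exact WithBot.coe_le_coe.2 (h1.trans h2)
end

section
/- Let R = K[[X,Y,U,V]]/(XY − UV), M' = coker(R → R^4, 1 ↦ (x,y,u,v)), and M = M'/xM'. Then proj dim_R M = 2, dim_R M = 2, and depth_R M = 1. -/
open CategoryTheory

/-- `Ext_R^n(M, N)` as a module category object. -/
noncomputable abbrev extMod (R : Type) [CommRing R] (n : ℕ)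
    (M N : Type) [AddCommGroup M] [Module R M] [AddCommGroup N] [Module R N] : ModuleCat R :=
  ((Ext R (ModuleCat R) n).obj (Opposite.op (ModuleCat.of R M))).obj (ModuleCat.of R N)

/-- `M` has projective dimension `n` over the local ring `R` with residue field `k`:
`Ext^{n+1}(M, -) = 0` and `Ext^n(M, k) ≠ 0`. -/
def HasProjDim (R : Type) [CommRing R] (k : Type) [AddCommGroup k] [Module R k]
    (M : Type) [AddCommGroup M] [Module R M] (n : ℕ) : Prop :=
  (∀ (N : Type) (_ : AddCommGroup N) (_ : Module R N), Subsingleton (extMod R (n + 1) M N)) ∧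
    Nontrivial (extMod R n M k)

/-- `M` has depth `n` over the local ring `R` with residue field `k`:
`Ext^i(k, M) = 0` for `i < n` and `Ext^n(k, M) ≠ 0`. -/
def HasDepth (R : Type) [CommRing R] (k : Type) [AddCommGroup k] [Module R k]
    (M : Type) [AddCommGroup M] [Module R M] (n : ℕ) : Prop :=
  (∀ i < n, Subsingleton (extMod R i k M)) ∧ Nontrivial (extMod R n k M)

/-- `R = K[[X,Y,U,V]]/(XY - UV)`. -/
noncomputable abbrev psHypersurface (K : Type) [Field K] : Type :=
  MvPowerSeries (Fin 4) K ⧸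
    Ideal.span {(MvPowerSeries.X 0 : MvPowerSeries (Fin 4) K) * MvPowerSeries.X 1 -
      MvPowerSeries.X 2 * MvPowerSeries.X 3}


/-- `M' = coker(R → R^4, 1 ↦ (x,y,u,v))`. -/
noncomputable abbrev Mprime (K : Type) [Field K] (x y u v : psHypersurface K) : Type :=
  (Fin 4 → psHypersurface K) ⧸ Submodule.span (psHypersurface K) {![x, y, u, v]}

/-- `M = M'/xM'`. -/
noncomputable abbrev Mmod (K : Type) [Field K] (x y u v : psHypersurface K) : Type :=
  Mprime K x y u v ⧸
    (Ideal.span {x} • (⊤ : Submodule (psHypersurface K) (Mprime K x y u v)))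

namespace MmodAux

lemma aux_sub_iff {R : Type} [CommRing R] {X Y : ModuleCat.{0} R} (P : ProjectiveResolution X) (n : ℕ) :
    Subsingleton (((Ext R (ModuleCat R) n).obj (Opposite.op X)).obj Y) ↔
      (P.complex.linearYonedaObj R Y).ExactAt n := by
  rw [HomologicalComplex.exactAt_iff_isZero_homology]
  rw [← (P.isoExt (R := R) n Y).isZero_iff]
  exact ModuleCat.isZero_iff_subsingleton.symm

lemma ext_succ_bridge {R : Type} [CommRing R] (X Y : ModuleCat.{0} R) (n : ℕ) :
    Subsingleton (((Ext R (ModuleCat R) (n+1)).obj (Opposite.op X)).obj Y) ↔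
      Subsingleton (Abelian.Ext X Y (n+1)) := by
  let P := projectiveResolution X
  rw [aux_sub_iff P, HomologicalComplex.exactAt_iff' _ n (n+1) (n+2) (by simp) (by simp),
    ShortComplex.moduleCat_exact_iff]
  constructor
  · intro h
    refine subsingleton_of_forall_eq 0 fun a => ?_
    obtain ⟨f, hf, rfl⟩ := P.extMk_surjective a (n+2) rfl
    rw [P.extMk_eq_zero_iff _ _ _ _ n rfl]
    exact h f hf
  · intro h f hf
    have := P.extMk_eq_zero_iff f (n+2) rfl hf n rfl
    exact this.1 (Subsingleton.elim _ _)

lemma ext_zero_sub {R : Type} [CommRing R] (X Y : ModuleCat.{0} R) (h : ∀ f : X ⟶ Y, f = 0) :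
    Subsingleton (((Ext R (ModuleCat R) 0).obj (Opposite.op X)).obj Y) := by
  let P := projectiveResolution X
  rw [aux_sub_iff P, HomologicalComplex.exactAt_iff' _ 0 0 1 (by simp) (by simp),
    ShortComplex.moduleCat_exact_iff]
  intro f hf
  have hf' : P.complex.d 1 0 ≫ f = 0 := hf
  have hg := P.exact₀.g_desc f hf'
  generalize P.exact₀.desc f hf' = g at hg
  refine ⟨0, ?_⟩
  rw [map_zero]
  have hg' : P.π.f 0 ≫ g = f := hg
  have hg0 : g = 0 := h g
  rw [hg0, Limits.comp_zero] at hg'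
  exact hg'

section
open scoped Pointwise

lemma pd_aux1 {R : Type} [CommRing R] (I : Ideal R) (hI : I ≠ ⊤) (w : Fin 4 → R) (hw : ∀ i, w i ∈ I)
    (h0 : ∀ r : R, r * w 0 = 0 → r = 0) :
    HasProjectiveDimensionLT (ModuleCat.of R ((Fin 4 → R) ⧸ Submodule.span R {w})) 2 ∧
    ¬ Subsingleton (Abelian.Ext (ModuleCat.of R ((Fin 4 → R) ⧸ Submodule.span R {w}))
      (ModuleCat.of R (R ⧸ I)) 1) := by
  let f : R →ₗ[R] (Fin 4 → R) := LinearMap.toSpanSingleton R _ w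
  let g := (Submodule.span R {w}).mkQ
  have hfg : Function.Exact f g := by
    rw [LinearMap.exact_iff]
    simp [f, g, LinearMap.range_toSpanSingleton]
  let S : ShortComplex (ModuleCat.{0} R) := ModuleCat.shortComplexOfCompEqZero f g hfg.linearMap_comp_eq_zero
  have hS : S.ShortExact :=
    { exact := ModuleCat.shortComplex_exact _ hfg
      mono_f := by
        rw [ModuleCat.mono_iff_injective]
        refine (injective_iff_map_eq_zero f).2 fun r hr => h0 r ?_
        simpa [f] using congrFun hr 0
      epi_g := by
        rw [ModuleCat.epi_iff_surjective]
        exact Submodule.mkQ_surjective _ }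
  have p1 : Projective S.X₁ := ModuleCat.projective_of_free (Module.Basis.singleton Unit R)
  have p2 : Projective S.X₂ := ModuleCat.projective_of_free (Pi.basisFun R (Fin 4))
  refine ⟨hS.hasProjectiveDimensionLT_X₃ 1 inferInstance inferInstance, fun hsub => ?_⟩
  have hsub' : Subsingleton (Abelian.Ext S.X₃ (ModuleCat.of R (R ⧸ I)) 1) := hsub
  let q : S.X₁ ⟶ ModuleCat.of R (R ⧸ I) := ModuleCat.ofHom (Submodule.mkQ I)
  obtain ⟨x₂, hx₂⟩ := Abelian.Ext.contravariant_sequence_exact₁ hS _ (Abelian.Ext.mk₀ q) (n₁ := 1) rfl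
    (Subsingleton.elim _ _)
  obtain ⟨φ, rfl⟩ := (Abelian.Ext.mk₀_bijective _ _).2 x₂
  rw [Abelian.Ext.mk₀_comp_mk₀, (Abelian.Ext.mk₀_bijective _ _).1.eq_iff] at hx₂
  have h1 : φ.hom (f 1) = Submodule.mkQ I 1 := congrArg (fun t => t.hom (1 : R)) hx₂
  have h2 : ∀ φ : (Fin 4 → R) →ₗ[R] (R ⧸ I), φ w = 0 := by
    intro φ
    rw [pi_eq_sum_univ w, map_sum]
    refine Finset.sum_eq_zero fun i _ => ?_
    rw [map_smul]
    obtain ⟨a, ha⟩ := Submodule.mkQ_surjective I (φ fun j => if i = j then 1 else 0)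
    rw [← ha, ← map_smul]
    exact (Submodule.Quotient.mk_eq_zero _).2 (I.mul_mem_right _ (hw i))
  have h3 : φ.hom (f 1) = 0 := by
    have := h2 φ.hom
    simpa [f] using this
  rw [h3] at h1
  exact hI ((Ideal.eq_top_iff_one I).2 ((Submodule.Quotient.mk_eq_zero _).1 h1.symm))

lemma pd_aux2 {R : Type} [CommRing R] (I : Ideal R) (x : R) (hx : x ∈ I)
    (M : Type) [AddCommGroup M] [Module R M] (hreg : IsSMulRegular M x)
    (h2 : HasProjectiveDimensionLT (ModuleCat.of R M) 2)
    (h1 : ¬ Subsingleton (Abelian.Ext (ModuleCat.of R M) (ModuleCat.of R (R ⧸ I)) 1)) :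
    HasProjectiveDimensionLT (ModuleCat.of R (M ⧸ (x • (⊤ : Submodule R M)))) 3 ∧
    ¬ Subsingleton (Abelian.Ext (ModuleCat.of R (M ⧸ (x • (⊤ : Submodule R M))))
      (ModuleCat.of R (R ⧸ I)) 2) := by
  have hS := IsSMulRegular.smulShortComplex_shortExact (M := ModuleCat.of R M) hreg
  refine ⟨hS.hasProjectiveDimensionLT_X₃ 2 h2 (@hasProjectiveDimensionLT_of_ge _ _ _ _ 2 3 (by simp) h2), fun hsub => h1 ?_⟩
  refine subsingleton_of_forall_eq 0 fun a => ?_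
  have hsub' : Subsingleton (Abelian.Ext (ModuleCat.smulShortComplex (ModuleCat.of R M) x).X₃ (ModuleCat.of R (R ⧸ I)) 2) := hsub
  obtain ⟨b, hb⟩ := Abelian.Ext.contravariant_sequence_exact₁ hS _ a (n₁ := 2) rfl
    (Subsingleton.elim _ _)
  have hb' : (Abelian.Ext.mk₀ (x • 𝟙 (ModuleCat.of R M))).comp
      (show Abelian.Ext (ModuleCat.of R M) (ModuleCat.of R (R ⧸ I)) 1 from b) (zero_add 1) = a := hb
  rw [← hb', Abelian.Ext.mk₀_smul, Abelian.Ext.smul_comp]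
  have hk : x • 𝟙 (ModuleCat.of R (R ⧸ I)) = 0 := by
    ext
    exact (Submodule.Quotient.mk_eq_zero _).2 (I.mul_mem_right _ hx)
  rw [Abelian.Ext.smul_eq_comp_mk₀, hk]
  simp

lemma hom_zero_aux {R : Type} [CommRing R] (I : Ideal R) (y : R) (hy : y ∈ I)
    (M : Type) [AddCommGroup M] [Module R M] (hreg : IsSMulRegular M y)
    (f : ModuleCat.of R (R ⧸ I) ⟶ ModuleCat.of R M) : f = 0 := by
  have hk : ∀ a : R ⧸ I, y • a = 0 := fun a => by
    obtain ⟨b, rfl⟩ := Submodule.mkQ_surjective I a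
    rw [← map_smul]
    exact (Submodule.Quotient.mk_eq_zero _).2 (I.mul_mem_right _ hy)
  apply ModuleCat.hom_ext
  refine LinearMap.ext fun a => hreg ?_
  change y • f.hom a = y • (0 : M)
  rw [smul_zero, ← map_smul]
  exact (congrArg f.hom (hk a)).trans (map_zero _)

lemma depth_aux {R : Type} [CommRing R] (I : Ideal R) (y : R) (hy : y ∈ I)
    (M : Type) [AddCommGroup M] [Module R M] (hreg : IsSMulRegular M y)
    (s : M) (hs : s ∉ y • (⊤ : Submodule R M)) (hIs : ∀ r ∈ I, r • s ∈ y • (⊤ : Submodule R M)) :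
    ¬ Subsingleton (Abelian.Ext (ModuleCat.of R (R ⧸ I)) (ModuleCat.of R M) 1) := by
  intro hsub
  have hS := IsSMulRegular.smulShortComplex_shortExact (M := ModuleCat.of R M) hreg
  have hsub' : Subsingleton (Abelian.Ext (ModuleCat.of R (R ⧸ I)) (ModuleCat.smulShortComplex (ModuleCat.of R M) y).X₁ 1) := hsub
  let q : (R ⧸ I) →ₗ[R] (M ⧸ (y • (⊤ : Submodule R M))) :=
    Submodule.liftQ I (LinearMap.toSpanSingleton R _ (Submodule.Quotient.mk s)) (by
      intro r hr
      rw [LinearMap.mem_ker, LinearMap.toSpanSingleton_apply, ← Submodule.Quotient.mk_smul]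
      exact (Submodule.Quotient.mk_eq_zero _).2 (hIs r hr))
  let q' : ModuleCat.of R (R ⧸ I) ⟶ (ModuleCat.smulShortComplex (ModuleCat.of R M) y).X₃ := ModuleCat.ofHom q
  obtain ⟨b, hb⟩ := Abelian.Ext.covariant_sequence_exact₃ _ hS (Abelian.Ext.mk₀ q') (n₁ := 1) rfl
    (Subsingleton.elim _ _)
  obtain ⟨φ, rfl⟩ := (Abelian.Ext.mk₀_bijective _ _).2 b
  have hφ : φ = 0 := hom_zero_aux I y hy M hreg φ
  rw [hφ, Abelian.Ext.mk₀_zero, Abelian.Ext.zero_comp, eq_comm, Abelian.Ext.mk₀_eq_zero_iff] at hb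
  have h1 : q (Submodule.Quotient.mk 1) = 0 := congrArg (fun t => t.hom (Submodule.Quotient.mk 1 : R ⧸ I)) hb
  apply hs
  rw [← Submodule.Quotient.mk_eq_zero]
  have h2 : q (Submodule.Quotient.mk 1) = Submodule.Quotient.mk s := by
    change Submodule.liftQ I _ _ (Submodule.Quotient.mk 1) = _
    rw [Submodule.liftQ_apply, LinearMap.toSpanSingleton_apply, one_smul]
  exact h2.symm.trans h1

end

section
open MvPowerSeries
/-- Auxiliary function: set the variable `i` to zero. -/
noncomputable def killFun (K : Type) [Field K] (i : Fin 4) (f : MvPowerSeries (Fin 4) K) :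
    MvPowerSeries (Fin 4) K := fun n => if n i = 0 then coeff n f else 0

lemma coeff_killFun {K : Type} [Field K] (i : Fin 4) (f : MvPowerSeries (Fin 4) K) (n : Fin 4 →₀ ℕ) :
    coeff n (killFun K i f) = if n i = 0 then coeff n f else 0 := rfl

/-- set variable i to zero -/
noncomputable def killVar (K : Type) [Field K] (i : Fin 4) :
    MvPowerSeries (Fin 4) K →+* MvPowerSeries (Fin 4) K where
  toFun := killFun K i
  map_one' := by
    ext n
    rw [coeff_killFun, coeff_one]
    by_cases h : n = 0 <;> simp [h]
  map_mul' f g := by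
    ext n
    rw [coeff_killFun, coeff_mul, coeff_mul]
    simp only [coeff_killFun]
    split_ifs with h
    · refine Finset.sum_congr rfl fun p hp => ?_
      have h1 : p.1 i + p.2 i = 0 := by
        rw [← Finsupp.add_apply, Finset.HasAntidiagonal.mem_antidiagonal.1 hp, h]
      rw [if_pos (by omega), if_pos (by omega)]
    · refine (Finset.sum_eq_zero fun p hp => ?_).symm
      have h1 : p.1 i + p.2 i = n i := by
        rw [← Finsupp.add_apply, Finset.HasAntidiagonal.mem_antidiagonal.1 hp]
      by_cases h2 : p.1 i = 0
      · rw [if_neg (c := p.2 i = 0) (by omega), mul_zero]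
      · rw [if_neg h2, zero_mul]
  map_zero' := by
    ext n
    simp [coeff_killFun]
  map_add' f g := by
    ext n
    simp only [coeff_killFun, map_add]
    split_ifs <;> simp

lemma coeff_killVar {K : Type} [Field K] (i : Fin 4) (f : MvPowerSeries (Fin 4) K) (n : Fin 4 →₀ ℕ) :
    coeff n (killVar K i f) = if n i = 0 then coeff n f else 0 := rfl

lemma killVar_X_self {K : Type} [Field K] (i : Fin 4) : killVar K i (X i) = 0 := by
  ext n
  rw [coeff_killVar, coeff_X]
  by_cases h : n = Finsupp.single i 1 <;> simp [h]

lemma killVar_X_ne {K : Type} [Field K] (i j : Fin 4) (hij : j ≠ i) : killVar K i (X j) = X j := by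
  ext n
  rw [coeff_killVar, coeff_X]
  by_cases h : n = Finsupp.single j 1 <;> simp [h, hij]

lemma killVar_sub {K : Type} [Field K] (i : Fin 4) (f : MvPowerSeries (Fin 4) K) :
    ∃ g, f = killVar K i f + X i * g := by
  have : X i ∣ f - killVar K i f := by
    rw [X_dvd_iff]
    intro m hm
    simp [coeff_killVar, hm]
  obtain ⟨g, hg⟩ := this
  exact ⟨g, by rw [← hg]; ring⟩

lemma X_ne {K : Type} [Field K] (i : Fin 4) : (X i : MvPowerSeries (Fin 4) K) ≠ 0 := by
  intro h
  have := congrArg (coeff (Finsupp.single i 1)) h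
  simp [coeff_X] at this

lemma kill2_split {K : Type} [Field K] (i j : Fin 4) (f : MvPowerSeries (Fin 4) K) :
    ∃ g h, f = killVar K i (killVar K j f) + X i * g + X j * h := by
  obtain ⟨h, hh⟩ := killVar_sub j f
  obtain ⟨g, hg⟩ := killVar_sub i (killVar K j f)
  exact ⟨g, h, by rw [← hg, ← hh]⟩

lemma mem_of_constantCoeff {K : Type} [Field K] (f : MvPowerSeries (Fin 4) K)
    (hf : constantCoeff f = 0) : ∃ a b c d, f = X 0 * a + X 1 * b + X 2 * c + X 3 * d := by
  obtain ⟨b, a, hab⟩ := kill2_split 1 0 f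
  obtain ⟨d, c, hcd⟩ := kill2_split 3 2 (killVar K 1 (killVar K 0 f))
  have h0 : killVar K 3 (killVar K 2 (killVar K 1 (killVar K 0 f))) = 0 := by
    ext n
    simp only [coeff_killVar, map_zero]
    split_ifs with h3 h2 h1 h0 <;> try rfl
    have : n = 0 := by
      ext i
      fin_cases i <;> assumption
    rw [this]
    simpa using hf
  rw [h0] at hcd
  exact ⟨a, b, c, d, by rw [hab, hcd]; ring⟩

lemma F1S {K : Type} [Field K] (f c : MvPowerSeries (Fin 4) K)
    (h : f * X 0 = c * (X 0 * X 1 - X 2 * X 3)) : ∃ d, f = d * (X 0 * X 1 - X 2 * X 3) := by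
  have h1 := congrArg (killVar K 0) h
  simp only [map_mul, map_sub, killVar_X_self, killVar_X_ne, ne_eq, Fin.reduceEq, not_false_eq_true,
    mul_zero, zero_mul, zero_sub] at h1
  have hc : killVar K 0 c = 0 := by
    have := mul_eq_zero.1 h1.symm
    simpa [X_ne] using this
  obtain ⟨d, hd⟩ := killVar_sub 0 c
  rw [hc] at hd
  refine ⟨d, mul_right_cancel₀ (X_ne 0) ?_⟩
  rw [h, hd]; ring

lemma F2S {K : Type} [Field K] (f g c : MvPowerSeries (Fin 4) K)
    (h : X 1 * f = X 0 * g + c * (X 0 * X 1 - X 2 * X 3)) :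
    ∃ d e, f = X 0 * d + e * (X 0 * X 1 - X 2 * X 3) := by
  have h1 := congrArg (fun t => killVar K 1 (killVar K 0 t)) h
  simp only [map_mul, map_neg, map_sub, map_add, killVar_X_self, killVar_X_ne, ne_eq, Fin.reduceEq,
    not_false_eq_true, mul_zero, zero_mul, zero_sub, zero_add, map_zero] at h1
  have hc : killVar K 1 (killVar K 0 c) = 0 := by
    have := mul_eq_zero.1 h1.symm
    simpa [X_ne] using this
  obtain ⟨e, d, hed⟩ := kill2_split 1 0 c
  rw [hc] at hed
  have h2 : X 1 * (f - e * (X 0 * X 1 - X 2 * X 3)) = X 0 * (g + d * (X 0 * X 1 - X 2 * X 3)) := by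
    rw [mul_sub, h, hed]; ring
  have h3 := congrArg (killVar K 0) h2
  rw [map_mul, map_mul, killVar_X_self, zero_mul, killVar_X_ne _ _ (by decide)] at h3
  obtain ⟨t, ht⟩ := killVar_sub 0 (f - e * (X 0 * X 1 - X 2 * X 3))
  rw [(mul_eq_zero.1 h3).resolve_left (X_ne 1)] at ht
  exact ⟨t, e, by linear_combination ht⟩

lemma F3S {K : Type} [Field K] (f g h p g' h' p' : MvPowerSeries (Fin 4) K)
    (H : f * X 2 = X 1 * g + X 0 * h + p * (X 0 * X 1 - X 2 * X 3))
    (H' : f * X 3 = X 1 * g' + X 0 * h' + p' * (X 0 * X 1 - X 2 * X 3)) :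
    ∃ d e q, f = X 1 * d + X 0 * e + q * (X 0 * X 1 - X 2 * X 3) := by
  have h1 := congrArg (fun t => killVar K 1 (killVar K 0 t)) H
  have h2 := congrArg (fun t => killVar K 1 (killVar K 0 t)) H'
  simp only [map_mul, map_neg, map_sub, map_add, killVar_X_self, killVar_X_ne, ne_eq, Fin.reduceEq,
    not_false_eq_true, mul_zero, zero_mul, zero_sub, zero_add, map_zero] at h1 h2
  obtain ⟨a, b, hab⟩ := kill2_split 1 0 f
  generalize killVar K 1 (killVar K 0 f) = F at *
  generalize killVar K 1 (killVar K 0 p) = P at *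
  generalize killVar K 1 (killVar K 0 p') = P' at *
  have h3 : F = - P * X 3 := mul_right_cancel₀ (X_ne 2) (by rw [h1]; ring)
  have h4 : F = - P' * X 2 := mul_right_cancel₀ (X_ne 3) (by rw [h2]; ring)
  have h5 := congrArg (killVar K 2) (h3.symm.trans h4)
  simp only [map_mul, map_neg, killVar_X_self, killVar_X_ne, ne_eq, Fin.reduceEq,
    not_false_eq_true, mul_zero] at h5
  have h6 : killVar K 2 P = 0 := by simpa [X_ne] using h5
  obtain ⟨q, hq⟩ := killVar_sub 2 P
  rw [h6] at hq
  refine ⟨a, b - q * X 1, q, ?_⟩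
  rw [hab, h3, hq]; ring

lemma F4S {K : Type} [Field K] (f g h p g' h' p' : MvPowerSeries (Fin 4) K)
    (H : f * X 2 = X 2 + X 1 * g + X 0 * h + p * (X 0 * X 1 - X 2 * X 3))
    (H' : f * X 3 = X 1 * g' + X 0 * h' + p' * (X 0 * X 1 - X 2 * X 3)) : False := by
  have h1 := congrArg (fun t => killVar K 1 (killVar K 0 t)) H
  have h2 := congrArg (fun t => killVar K 1 (killVar K 0 t)) H'
  simp only [map_mul, map_neg, map_sub, map_add, killVar_X_self, killVar_X_ne, ne_eq, Fin.reduceEq,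
    not_false_eq_true, mul_zero, zero_mul, zero_sub, zero_add, add_zero, map_zero] at h1 h2
  generalize killVar K 1 (killVar K 0 f) = F at *
  generalize killVar K 1 (killVar K 0 p) = P at *
  generalize killVar K 1 (killVar K 0 p') = P' at *
  have h4 : F = - P' * X 2 := mul_right_cancel₀ (X_ne 3) (by rw [h2]; ring)
  have h3 : F = 1 - P * X 3 := mul_right_cancel₀ (X_ne 2) (by rw [h1]; ring)
  have h5 := congrArg constantCoeff (h3.symm.trans h4)
  simp at h5

lemma dim_ge {K : Type} [Field K] (n : ℕ) : (n : WithBot ℕ∞) ≤ ringKrullDim (MvPowerSeries (Fin n) K) := by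
  induction n with
  | zero => exact_mod_cast ringKrullDim_nonneg_of_nontrivial
  | succ n ih =>
    have := ringKrullDim_succ_le_of_surjective
      (killCompl (R := K) (Fin.castSuccEmb (n := n))).toRingHom
      (fun p => ⟨rename _ p, killCompl_rename_app p⟩)
      (r := X (Fin.last n)) X_mem_nonzeroDivisors
      (killCompl_X_eq_zero (by rintro ⟨i, hi⟩; exact (Fin.castSucc_lt_last i).ne hi))
    refine le_trans ?_ this
    push_cast
    gcongr

end

/-- The algebraic facts used on the ring `R` and its elements `x, y, u, v`. -/
structure GoodRing (R : Type) [CommRing R] (x y u v : R) : Prop where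
  rel : x * y = u * v
  F1 : ∀ a, a * x = 0 → a = 0
  F2 : ∀ a b, y * a = x * b → ∃ c, a = x * c
  F3 : ∀ a b c b' c', a * u = y * b + x * c → a * v = y * b' + x * c' → ∃ d e, a = y * d + x * e
  F4 : ∀ a b c b' c', a * u = u + y * b + x * c → a * v = y * b' + x * c' → False

section
open scoped Pointwise

/-- `R⁴/(w)` -/
abbrev MpG (R : Type) [CommRing R] (x y u v : R) : Type :=
  (Fin 4 → R) ⧸ Submodule.span R {![x, y, u, v]}

/-- `M'/xM'` -/
abbrev MG (R : Type) [CommRing R] (x y u v : R) : Type :=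
  MpG R x y u v ⧸ (Ideal.span {x} • (⊤ : Submodule R (MpG R x y u v)))

/-- class of a vector in `M` -/
def cls {R : Type} [CommRing R] (x y u v : R) (m : Fin 4 → R) : MG R x y u v :=
  Submodule.Quotient.mk (Submodule.Quotient.mk m)

lemma cls_surj {R : Type} [CommRing R] (x y u v : R) (a : MG R x y u v) : ∃ m, a = cls x y u v m := by
  obtain ⟨b, rfl⟩ := Submodule.Quotient.mk_surjective _ a
  obtain ⟨c, rfl⟩ := Submodule.Quotient.mk_surjective _ b
  exact ⟨c, rfl⟩

lemma cls_smul {R : Type} [CommRing R] (x y u v r : R) (m : Fin 4 → R) :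
    r • cls x y u v m = cls x y u v (r • m) := rfl

lemma cls_sub {R : Type} [CommRing R] (x y u v : R) (m n : Fin 4 → R) :
    cls x y u v m - cls x y u v n = cls x y u v (m - n) := rfl

lemma mp_zero_iff {R : Type} [CommRing R] (x y u v : R) (m : Fin 4 → R) :
    (Submodule.Quotient.mk m : MpG R x y u v) = 0 ↔ ∃ r : R, m = r • ![x, y, u, v] := by
  rw [Submodule.Quotient.mk_eq_zero, Submodule.mem_span_singleton]
  simp only [eq_comm]

lemma cls_zero_iff {R : Type} [CommRing R] (x y u v : R) (m : Fin 4 → R) :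
    cls x y u v m = 0 ↔ ∃ (n : Fin 4 → R) (r : R), m = x • n + r • ![x, y, u, v] := by
  rw [cls, Submodule.Quotient.mk_eq_zero, Submodule.ideal_span_singleton_smul,
    Submodule.mem_smul_pointwise_iff_exists]
  constructor
  · rintro ⟨b, -, hb⟩
    obtain ⟨n, rfl⟩ := Submodule.Quotient.mk_surjective _ b
    rw [← Submodule.Quotient.mk_smul, eq_comm, ← sub_eq_zero, ← Submodule.Quotient.mk_sub,
      mp_zero_iff] at hb
    obtain ⟨r, hr⟩ := hb
    exact ⟨n, r, by rw [← hr]; abel⟩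
  · rintro ⟨n, r, rfl⟩
    refine ⟨Submodule.Quotient.mk n, trivial, ?_⟩
    rw [← Submodule.Quotient.mk_smul, eq_comm, ← sub_eq_zero, ← Submodule.Quotient.mk_sub,
      mp_zero_iff]
    exact ⟨r, by abel⟩

lemma reg_Mp {R : Type} [CommRing R] {x y u v : R} (G : GoodRing R x y u v) :
    IsSMulRegular (MpG R x y u v) x := by
  intro a b hab
  rw [← sub_eq_zero]
  have h : x • (a - b) = 0 := by rw [smul_sub, sub_eq_zero]; exact hab
  obtain ⟨m, hm⟩ := Submodule.Quotient.mk_surjective _ (a - b)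
  rw [← hm] at h ⊢
  rw [← Submodule.Quotient.mk_smul, mp_zero_iff] at h
  rw [mp_zero_iff]
  obtain ⟨r, hr⟩ := h
  have e0 : x * m 0 = r * x := by simpa using congrFun hr 0
  have e1 : x * m 1 = r * y := by simpa using congrFun hr 1
  have e2 : x * m 2 = r * u := by simpa using congrFun hr 2
  have e3 : x * m 3 = r * v := by simpa using congrFun hr 3
  obtain ⟨c, hc⟩ := G.F2 r (m 1) (by rw [e1]; ring)
  subst hc
  have can : ∀ p q, x * p = x * c * q → p = c * q := fun p q h =>
    sub_eq_zero.1 (G.F1 _ (by linear_combination h))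
  refine ⟨c, funext fun i => ?_⟩
  fin_cases i
  · simpa using can _ _ e0
  · simpa using can _ _ e1
  · simpa using can _ _ e2
  · simpa using can _ _ e3

lemma reg_M {R : Type} [CommRing R] {x y u v : R} (G : GoodRing R x y u v) :
    IsSMulRegular (MG R x y u v) y := by
  intro a b hab
  rw [← sub_eq_zero]
  have h : y • (a - b) = 0 := by rw [smul_sub, sub_eq_zero]; exact hab
  obtain ⟨m, hm⟩ := cls_surj x y u v (a - b)
  rw [hm] at h ⊢
  rw [cls_smul, cls_zero_iff] at h
  rw [cls_zero_iff]
  obtain ⟨n, r, hr⟩ := h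
  have e0 : y * m 0 = x * n 0 + r * x := by simpa using congrFun hr 0
  have e1 : y * m 1 = x * n 1 + r * y := by simpa using congrFun hr 1
  have e2 : y * m 2 = x * n 2 + r * u := by simpa using congrFun hr 2
  have e3 : y * m 3 = x * n 3 + r * v := by simpa using congrFun hr 3
  obtain ⟨d, e, hde⟩ := G.F3 r (m 2) (-n 2) (m 3) (-n 3) (by linear_combination -e2)
    (by linear_combination -e3)
  obtain ⟨c0, h0⟩ := G.F2 (m 0) (n 0 + r) (by linear_combination e0)
  obtain ⟨c1, h1⟩ := G.F2 (m 1 - r) (n 1) (by linear_combination e1)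
  obtain ⟨c2, h2⟩ := G.F2 (m 2 - d * u) (n 2 + e * u) (by linear_combination e2 + u * hde)
  obtain ⟨c3, h3⟩ := G.F2 (m 3 - d * v) (n 3 + e * v) (by linear_combination e3 + v * hde)
  refine ⟨![c0 - d, c1 + e, c2, c3], d, funext fun i => ?_⟩
  fin_cases i
  · simp; linear_combination h0
  · simp; linear_combination h1 + hde
  · simp; linear_combination h2
  · simp; linear_combination h3

lemma cls_mem_iff {R : Type} [CommRing R] (x y u v : R) (m : Fin 4 → R) :
    cls x y u v m ∈ y • (⊤ : Submodule R (MG R x y u v)) ↔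
      ∃ (a n : Fin 4 → R) (r : R), m = y • a + x • n + r • ![x, y, u, v] := by
  rw [Submodule.mem_smul_pointwise_iff_exists]
  constructor
  · rintro ⟨b, -, hb⟩
    obtain ⟨a, rfl⟩ := cls_surj x y u v b
    rw [cls_smul, eq_comm, ← sub_eq_zero, cls_sub, cls_zero_iff] at hb
    obtain ⟨n, r, h⟩ := hb
    exact ⟨a, n, r, by rw [add_assoc, ← h]; abel⟩
  · rintro ⟨a, n, r, rfl⟩
    refine ⟨cls x y u v a, trivial, ?_⟩
    rw [cls_smul, eq_comm, ← sub_eq_zero, cls_sub, cls_zero_iff]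
    exact ⟨n, r, by abel⟩

lemma soc_notMem {R : Type} [CommRing R] {x y u v : R} (G : GoodRing R x y u v) :
    cls x y u v ![0, 0, u, 0] ∉ y • (⊤ : Submodule R (MG R x y u v)) := by
  rw [cls_mem_iff]
  rintro ⟨a, n, r, h⟩
  have e2 : u = y * a 2 + x * n 2 + r * u := by simpa using congrFun h 2
  have e3 : 0 = y * a 3 + x * n 3 + r * v := by simpa using congrFun h 3
  exact G.F4 r (-a 2) (-n 2) (-a 3) (-n 3) (by linear_combination -e2) (by linear_combination -e3)

lemma soc_mem {R : Type} [CommRing R] {x y u v : R} (G : GoodRing R x y u v) (r : R)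
    (hr : r ∈ Ideal.span {x, y, u, v}) :
    r • cls x y u v ![0, 0, u, 0] ∈ y • (⊤ : Submodule R (MG R x y u v)) := by
  have key : Ideal.span {x, y, u, v} ≤ Submodule.comap
      (LinearMap.toSpanSingleton R (MG R x y u v) (cls x y u v ![0, 0, u, 0]))
      (y • (⊤ : Submodule R (MG R x y u v))) := by
    refine Submodule.span_le.2 ?_
    have rel := G.rel
    rintro t (rfl | rfl | rfl | rfl)
    all_goals
      rw [SetLike.mem_coe, Submodule.mem_comap, LinearMap.toSpanSingleton_apply, cls_smul,
        cls_mem_iff]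
    · exact ⟨0, ![0, 0, u, 0], 0, by simp⟩
    · exact ⟨![0, 0, u, 0], 0, 0, by simp⟩
    · refine ⟨![0, -t, 0, -x], ![-t, 0, 0, 0], t, funext fun i => ?_⟩
      fin_cases i <;> simp <;> first | ring1 | linear_combination rel
    · refine ⟨0, ![0, 0, y, 0], 0, funext fun i => ?_⟩
      fin_cases i <;> simp <;> linear_combination -rel
  exact key hr

lemma ann_le {R : Type} [CommRing R] {x y u v : R} (r : R)
    (hr : r ∈ Module.annihilator R (MG R x y u v)) : ∃ c, r = x * c := by
  have := Module.mem_annihilator.1 hr (cls x y u v ![1, 0, 0, 0])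
  rw [cls_smul, cls_zero_iff] at this
  obtain ⟨n, t, h⟩ := this
  have e0 : r = x * n 0 + t * x := by simpa using congrFun h 0
  exact ⟨n 0 + t, by rw [e0]; ring⟩

lemma x_mem_ann {R : Type} [CommRing R] (x y u v : R) :
    x ∈ Module.annihilator R (MG R x y u v) := by
  rw [Module.mem_annihilator]
  intro a
  obtain ⟨m, rfl⟩ := cls_surj x y u v a
  rw [cls_smul, cls_zero_iff]
  exact ⟨m, 0, by simp⟩

end

section
open MvPowerSeries

lemma goodRing_ps (K : Type) [Field K] (x y u v : psHypersurface K)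
    (hx : x = Ideal.Quotient.mk _ (MvPowerSeries.X 0))
    (hy : y = Ideal.Quotient.mk _ (MvPowerSeries.X 1))
    (hu : u = Ideal.Quotient.mk _ (MvPowerSeries.X 2))
    (hv : v = Ideal.Quotient.mk _ (MvPowerSeries.X 3)) :
    GoodRing (psHypersurface K) x y u v := by
  subst hx hy hu hv
  have key : ∀ f g : MvPowerSeries (Fin 4) K,
      (Ideal.Quotient.mk (Ideal.span {(X 0 : MvPowerSeries (Fin 4) K) * X 1 - X 2 * X 3}) f =
        Ideal.Quotient.mk _ g) ↔ ∃ c, f = g + c * (X 0 * X 1 - X 2 * X 3) := by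
    intro f g
    rw [Ideal.Quotient.eq, Ideal.mem_span_singleton']
    constructor
    · rintro ⟨c, hc⟩; exact ⟨c, by rw [hc]; ring⟩
    · rintro ⟨c, hc⟩; exact ⟨c, by rw [hc]; ring⟩
  constructor
  · rw [← map_mul, ← map_mul, key]
    exact ⟨1, by ring⟩
  · intro a h
    obtain ⟨a, rfl⟩ := Ideal.Quotient.mk_surjective a
    rw [← map_mul, ← map_zero (Ideal.Quotient.mk _), key] at h
    obtain ⟨c, h⟩ := h
    obtain ⟨d, hd⟩ := F1S a c (by rw [h]; ring)
    rw [← map_zero (Ideal.Quotient.mk _), key]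
    exact ⟨d, by rw [hd]; ring⟩
  · intro a b h
    obtain ⟨a, rfl⟩ := Ideal.Quotient.mk_surjective a
    obtain ⟨b, rfl⟩ := Ideal.Quotient.mk_surjective b
    rw [← map_mul, ← map_mul, key] at h
    obtain ⟨c, h⟩ := h
    obtain ⟨d, e, hd⟩ := F2S a b c h
    refine ⟨Ideal.Quotient.mk _ d, ?_⟩
    rw [← map_mul, key]
    exact ⟨e, hd⟩
  · intro a b c b' c' h h'
    obtain ⟨a, rfl⟩ := Ideal.Quotient.mk_surjective a
    obtain ⟨b, rfl⟩ := Ideal.Quotient.mk_surjective b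
    obtain ⟨c, rfl⟩ := Ideal.Quotient.mk_surjective c
    obtain ⟨b', rfl⟩ := Ideal.Quotient.mk_surjective b'
    obtain ⟨c', rfl⟩ := Ideal.Quotient.mk_surjective c'
    simp only [← map_mul, ← map_add] at h h'
    rw [key] at h h'
    obtain ⟨p, h⟩ := h
    obtain ⟨p', h'⟩ := h'
    obtain ⟨d, e, q, hd⟩ := F3S a b c p b' c' p' h h'
    refine ⟨Ideal.Quotient.mk _ d, Ideal.Quotient.mk _ e, ?_⟩
    simp only [← map_mul, ← map_add]
    rw [key]
    exact ⟨q, hd⟩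
  · intro a b c b' c' h h'
    obtain ⟨a, rfl⟩ := Ideal.Quotient.mk_surjective a
    obtain ⟨b, rfl⟩ := Ideal.Quotient.mk_surjective b
    obtain ⟨c, rfl⟩ := Ideal.Quotient.mk_surjective c
    obtain ⟨b', rfl⟩ := Ideal.Quotient.mk_surjective b'
    obtain ⟨c', rfl⟩ := Ideal.Quotient.mk_surjective c'
    simp only [← map_mul, ← map_add] at h h'
    rw [key] at h h'
    obtain ⟨p, h⟩ := h
    obtain ⟨p', h'⟩ := h'
    exact F4S a b c p b' c' p' h h'

lemma span_ne_top (K : Type) [Field K] (x y u v : psHypersurface K)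
    (hx : x = Ideal.Quotient.mk _ (MvPowerSeries.X 0))
    (hy : y = Ideal.Quotient.mk _ (MvPowerSeries.X 1))
    (hu : u = Ideal.Quotient.mk _ (MvPowerSeries.X 2))
    (hv : v = Ideal.Quotient.mk _ (MvPowerSeries.X 3)) :
    Ideal.span {x, y, u, v} ≠ ⊤ := by
  subst hx hy hu hv
  let φ : psHypersurface K →+* K := Ideal.Quotient.lift _ (constantCoeff (σ := Fin 4) (R := K)) (by
    intro a ha
    obtain ⟨c, rfl⟩ := Ideal.mem_span_singleton'.1 ha
    simp)
  have hle : Ideal.span {Ideal.Quotient.mk _ (MvPowerSeries.X 0),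
      Ideal.Quotient.mk _ (MvPowerSeries.X 1), Ideal.Quotient.mk _ (MvPowerSeries.X 2),
      Ideal.Quotient.mk _ (MvPowerSeries.X 3)} ≤ RingHom.ker φ := by
    rw [Ideal.span_le]
    rintro r (rfl | rfl | rfl | rfl) <;>
    · change constantCoeff (X _) = (0 : K)
      simp
  intro h
  rw [h] at hle
  exact (RingHom.ker_ne_top φ) (top_le_iff.1 hle)

lemma dim_lower {K : Type} [Field K] {Q : Type} [CommRing Q] (φ : MvPowerSeries (Fin 4) K →+* Q)
    (hs : Function.Surjective φ)
    (hk : ∀ f, φ f = 0 → ∃ c d, f = X 0 * c + d * (X 0 * X 1 - X 2 * X 3)) :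
    2 ≤ ringKrullDim Q := by
  let e : Fin 2 ↪ Fin 4 := ⟨![1, 3], by decide⟩
  let ψ : MvPowerSeries (Fin 4) K →+* MvPowerSeries (Fin 2) K := (killCompl (R := K) e).toRingHom
  have h0 : ψ (X 0) = 0 := killCompl_X_eq_zero (by decide)
  have h2 : ψ (X 2) = 0 := killCompl_X_eq_zero (by decide)
  have hψ : Function.Surjective ψ := fun p => ⟨rename e p, killCompl_rename_app p⟩
  have hker : ∀ f, φ f = 0 → ψ f = 0 := by
    intro f hf
    obtain ⟨c, d, rfl⟩ := hk f hf
    simp [h0, h2]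
  let χ : Q →+* MvPowerSeries (Fin 2) K := RingHom.liftOfSurjective φ hs ⟨ψ, fun f hf => hker f hf⟩
  have hχ : Function.Surjective χ := by
    intro p
    obtain ⟨f, rfl⟩ := hψ p
    exact ⟨φ f, RingHom.liftOfRightInverse_comp_apply _ _ _ _ _⟩
  exact (dim_ge 2).trans (ringKrullDim_le_of_surjective χ hχ)

lemma dim_upper {K : Type} [Field K] {Q : Type} [CommRing Q] [Nontrivial Q]
    (φ : MvPowerSeries (Fin 4) K →+* Q)
    (hs : Function.Surjective φ) (h0 : φ (X 0) = 0) (h23 : φ (X 2) * φ (X 3) = 0) :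
    ringKrullDim Q ≤ 2 := by
  have : IsLocalRing Q := IsLocalRing.of_surjective' φ hs
  have : IsNoetherianRing Q := isNoetherianRing_of_surjective _ _ φ hs
  rw [← IsLocalRing.maximalIdeal_height_eq_ringKrullDim]
  have hmax : ∀ i, φ (X i) ∈ IsLocalRing.maximalIdeal Q := by
    intro i
    have hl : IsLocalHom φ := IsLocalHom.of_surjective φ hs
    rw [IsLocalRing.mem_maximalIdeal, mem_nonunits_iff, isUnit_map_iff,
      MvPowerSeries.isUnit_iff_constantCoeff]
    simp
  have hmin : IsLocalRing.maximalIdeal Q ∈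
      (Ideal.span {φ (X 1), φ (X 2) - φ (X 3)}).minimalPrimes := by
    refine ⟨⟨inferInstance, ?_⟩, ?_⟩
    · rw [Ideal.span_le]
      rintro r (rfl | rfl)
      · exact hmax 1
      · exact sub_mem (hmax 2) (hmax 3)
    · rintro p ⟨hp, hle⟩ - q hq
      have h1 : φ (X 1) ∈ p := hle (Ideal.subset_span (by simp))
      have hd : φ (X 2) - φ (X 3) ∈ p := hle (Ideal.subset_span (by simp))
      have h23' : φ (X 2) ∈ p ∧ φ (X 3) ∈ p := by
        rcases hp.mem_or_mem (h23 ▸ p.zero_mem : φ (X 2) * φ (X 3) ∈ p) with h | h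
        · exact ⟨h, by simpa using sub_mem h hd⟩
        · exact ⟨by simpa using add_mem hd h, h⟩
      obtain ⟨f, rfl⟩ := hs q
      have hf : constantCoeff f = 0 := by
        by_contra hne
        refine hq ?_
        exact ((MvPowerSeries.isUnit_iff_constantCoeff).2 (isUnit_iff_ne_zero.2 hne)).map φ
      obtain ⟨a, b, c, d, rfl⟩ := mem_of_constantCoeff f hf
      simp only [map_add, map_mul, h0, zero_mul, zero_add]
      exact add_mem (add_mem (p.mul_mem_right _ h1) (p.mul_mem_right _ h23'.1))
        (p.mul_mem_right _ h23'.2)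
  have h := Ideal.height_le_card_of_mem_minimalPrimes_span (Set.toFinite _) hmin
  have h2 : (IsLocalRing.maximalIdeal Q).height ≤ 2 :=
    h.trans (by exact_mod_cast (Set.ncard_insert_le _ _).trans (by simp))
  exact WithBot.coe_le_coe.2 h2

lemma dim_main (K : Type) [Field K] (x y u v : psHypersurface K)
    (hx : x = Ideal.Quotient.mk _ (MvPowerSeries.X 0))
    (hy : y = Ideal.Quotient.mk _ (MvPowerSeries.X 1))
    (hu : u = Ideal.Quotient.mk _ (MvPowerSeries.X 2))
    (hv : v = Ideal.Quotient.mk _ (MvPowerSeries.X 3)) :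
    ringKrullDim (psHypersurface K ⧸
        Module.annihilator (psHypersurface K) (Mmod K x y u v)) = 2 := by
  have G := goodRing_ps K x y u v hx hy hu hv
  let φ : MvPowerSeries (Fin 4) K →+* (psHypersurface K ⧸
        Module.annihilator (psHypersurface K) (Mmod K x y u v)) :=
    (Ideal.Quotient.mk _).comp (Ideal.Quotient.mk _)
  have hs : Function.Surjective φ :=
    Ideal.Quotient.mk_surjective.comp Ideal.Quotient.mk_surjective
  have hk : ∀ f, φ f = 0 → ∃ c d, f = X 0 * c + d * (X 0 * X 1 - X 2 * X 3) := by
    intro f hf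
    have hf' : Ideal.Quotient.mk _ f ∈ Module.annihilator (psHypersurface K) (Mmod K x y u v) :=
      Ideal.Quotient.eq_zero_iff_mem.1 hf
    obtain ⟨c, hc⟩ := ann_le _ hf'
    obtain ⟨c, rfl⟩ := Ideal.Quotient.mk_surjective c
    rw [hx, ← map_mul, Ideal.Quotient.eq, Ideal.mem_span_singleton'] at hc
    obtain ⟨d, hd⟩ := hc
    exact ⟨c, d, by rw [hd]; ring⟩
  have hlow : 2 ≤ ringKrullDim (psHypersurface K ⧸
      Module.annihilator (psHypersurface K) (Mmod K x y u v)) :=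
    @dim_lower K _ (psHypersurface K ⧸
      Module.annihilator (psHypersurface K) (Mmod K x y u v)) _ φ hs hk
  have hnt : Nontrivial (psHypersurface K ⧸
        Module.annihilator (psHypersurface K) (Mmod K x y u v)) := by
    by_contra hn
    rw [not_nontrivial_iff_subsingleton] at hn
    rw [ringKrullDim_eq_bot_of_subsingleton] at hlow
    exact absurd hlow (by decide)
  have h0 : φ (X 0) = 0 := by
    refine Ideal.Quotient.eq_zero_iff_mem.2 ?_
    rw [← hx]
    exact x_mem_ann x y u v
  refine le_antisymm (@dim_upper K _ (psHypersurface K ⧸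
      Module.annihilator (psHypersurface K) (Mmod K x y u v)) _ hnt φ hs h0 ?_) hlow
  rw [← map_mul]
  refine Ideal.Quotient.eq_zero_iff_mem.2 ?_
  rw [map_mul, ← hu, ← hv, ← G.rel]
  exact Ideal.mul_mem_right _ _ (x_mem_ann x y u v)

end

lemma pd_aux3 {R : Type} [CommRing R] (I : Ideal R) (x y u v : R) (G : GoodRing R x y u v)
    (hI : I = Ideal.span {x, y, u, v}) (hne : I ≠ ⊤) :
    HasProjectiveDimensionLT (ModuleCat.of R (MG R x y u v)) 3 ∧
      ¬ Subsingleton (Abelian.Ext (ModuleCat.of R (MG R x y u v)) (ModuleCat.of R (R ⧸ I)) 2) := by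
  have hw : ∀ i, (![x, y, u, v] : Fin 4 → R) i ∈ I := by
    intro i
    rw [hI]
    apply Ideal.subset_span
    fin_cases i <;> simp
  obtain ⟨h2, h1⟩ := pd_aux1 I hne ![x, y, u, v] hw G.F1
  have h := pd_aux2 I x (hw 0) (MpG R x y u v) (reg_Mp G) h2 h1
  rw [← Submodule.ideal_span_singleton_smul] at h
  exact h

end MmodAux

/-- For `R = K[[X,Y,U,V]]/(XY-UV)` and `M = M'/xM'`:
`proj dim_R M = 2`, `dim_R M = 2` and `depth_R M = 1`. -/
theorem Mmod_projDim_dim_depth (K : Type) [Field K]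
    (x y u v : psHypersurface K)
    (hx : x = Ideal.Quotient.mk _ (MvPowerSeries.X 0))
    (hy : y = Ideal.Quotient.mk _ (MvPowerSeries.X 1))
    (hu : u = Ideal.Quotient.mk _ (MvPowerSeries.X 2))
    (hv : v = Ideal.Quotient.mk _ (MvPowerSeries.X 3)) :
    HasProjDim (psHypersurface K) (psHypersurface K ⧸ Ideal.span {x, y, u, v})
        (Mmod K x y u v) 2 ∧
      ringKrullDim (psHypersurface K ⧸
        Module.annihilator (psHypersurface K) (Mmod K x y u v)) = 2 ∧
      HasDepth (psHypersurface K) (psHypersurface K ⧸ Ideal.span {x, y, u, v})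
        (Mmod K x y u v) 1 := by
  have G := MmodAux.goodRing_ps K x y u v hx hy hu hv
  have hne := MmodAux.span_ne_top K x y u v hx hy hu hv
  have hyI : y ∈ Ideal.span {x, y, u, v} := Ideal.subset_span (by simp)
  refine ⟨⟨?_, ?_⟩, MmodAux.dim_main K x y u v hx hy hu hv, ⟨?_, ?_⟩⟩
  · intro N _ _
    have h := (MmodAux.pd_aux3 _ x y u v G rfl hne).1
    refine (MmodAux.ext_succ_bridge (ModuleCat.of _ (Mmod K x y u v)) (ModuleCat.of _ N) 2).2 ?_
    exact HasProjectiveDimensionLT.subsingleton _ 3 3 le_rfl _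
  · have h := (MmodAux.pd_aux3 _ x y u v G rfl hne).2
    rw [← not_subsingleton_iff_nontrivial]
    exact fun hs => h ((MmodAux.ext_succ_bridge _ _ 1).1 hs)
  · intro i hi
    obtain rfl : i = 0 := by omega
    exact MmodAux.ext_zero_sub _ _
      (MmodAux.hom_zero_aux _ y hyI (Mmod K x y u v) (MmodAux.reg_M G))
  · rw [← not_subsingleton_iff_nontrivial]
    intro hs
    exact MmodAux.depth_aux _ y hyI (Mmod K x y u v) (MmodAux.reg_M G) _
      (MmodAux.soc_notMem G) (fun r hr => MmodAux.soc_mem G r hr)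
      ((MmodAux.ext_succ_bridge _ _ 0).1 hs)
end

section
/- Let R = K[[X,Y,U,V]]/(XY − UV), M' = coker(R → R^4, 1 ↦ (x,y,u,v)), and M = M'/xM'. Then Ext_R^2(M, R) ≅ K, the residue field of R. -/
open CategoryTheory

section ps
variable {K : Type} [Field K]
open MvPowerSeries

lemma ps_coeff_X_mul_of_zero (i : Fin 4) (A : MvPowerSeries (Fin 4) K) (m : Fin 4 →₀ ℕ)
    (hm : m i = 0) : coeff m (X i * A) = 0 :=
  X_dvd_iff.1 (Dvd.intro _ rfl) m hm

lemma ps_coeff_UV (C : MvPowerSeries (Fin 4) K) (m : Fin 4 →₀ ℕ) :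
    coeff (m + Finsupp.single 2 1 + Finsupp.single 3 1) (C * X 2 * X 3) = coeff m C := by
  rw [X, X, coeff_add_mul_monomial, coeff_add_mul_monomial]; simp

lemma ps_reg {A C : MvPowerSeries (Fin 4) K}
    (h : X 0 * A = C * (X 0 * X 1 - X 2 * X 3)) :
    ∃ D, A = D * (X 0 * X 1 - X 2 * X 3) := by
  have hC : (X 0 : MvPowerSeries (Fin 4) K) ∣ C := by
    rw [X_dvd_iff]
    intro m hm
    rw [← ps_coeff_UV C m]
    have : C * X 2 * X 3 = X 0 * (C * X 1 - A) := by linear_combination h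
    rw [this]
    apply ps_coeff_X_mul_of_zero
    simp [hm]
  obtain ⟨D, rfl⟩ := hC
  refine ⟨D, ?_⟩
  have hX : (X 0 : MvPowerSeries (Fin 4) K) ∈ nonZeroDivisors _ := X_mem_nonzeroDivisors
  refine (mul_cancel_left_mem_nonZeroDivisors hX).1 ?_
  rw [h]; ring

lemma ps_reg2 {A B C : MvPowerSeries (Fin 4) K}
    (h : X 0 * A = B * X 1 + C * (X 0 * X 1 - X 2 * X 3)) :
    ∃ D E, B = X 0 * D + E * (X 0 * X 1 - X 2 * X 3) := by
  have hC : ∀ m : Fin 4 →₀ ℕ, m 0 = 0 → m 1 = 0 → coeff m C = 0 := by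
    intro m h0 h1
    rw [← ps_coeff_UV C m]
    have : C * X 2 * X 3 = X 1 * B + X 0 * (C * X 1 - A) := by linear_combination h
    rw [this, map_add, ps_coeff_X_mul_of_zero, ps_coeff_X_mul_of_zero, add_zero] <;> simp [h0, h1]
  let C1 : MvPowerSeries (Fin 4) K := fun m => if m 0 = 0 then 0 else coeff m C
  have hc1 : ∀ m, coeff m C1 = if m 0 = 0 then 0 else coeff m C := fun m => rfl
  have d1 : (X 0 : MvPowerSeries (Fin 4) K) ∣ C1 := by
    rw [X_dvd_iff]; intro m hm; simp [hc1, hm]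
  have d2 : (X 1 : MvPowerSeries (Fin 4) K) ∣ C - C1 := by
    rw [X_dvd_iff]; intro m hm
    rw [map_sub, hc1]
    by_cases h0 : m 0 = 0
    · simp [h0, hC m h0 hm]
    · simp [h0]
  obtain ⟨P, hP⟩ := d1
  obtain ⟨Q, hQ⟩ := d2
  have hCe : C = X 0 * P + X 1 * Q := by linear_combination hP + hQ
  -- Y (B - Q UV) is divisible by X
  have key : (X 0 : MvPowerSeries (Fin 4) K) ∣ B - Q * X 2 * X 3 := by
    rw [X_dvd_iff]
    intro m hm
    have e : (B - Q * X 2 * X 3) * X 1 = X 0 * (A - C * X 1 + P * X 2 * X 3) := by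
      rw [hCe] at h ⊢
      linear_combination -h
    have := coeff_add_mul_monomial m (Finsupp.single 1 1) (B - Q * X 2 * X 3) (1 : K)
    rw [mul_one] at this
    rw [← this]
    change coeff _ ((B - Q * X 2 * X 3) * X 1) = 0
    rw [e]
    apply ps_coeff_X_mul_of_zero
    simp [hm]
  obtain ⟨D, hD⟩ := key
  exact ⟨D + Q * X 1, -Q, by linear_combination hD⟩
end ps

lemma R_reg {K : Type} [Field K] (a : psHypersurface K)
    (h : Ideal.Quotient.mk _ (MvPowerSeries.X 0) * a = 0) : a = 0 := by
  obtain ⟨A, rfl⟩ := Ideal.Quotient.mk_surjective a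
  rw [← map_mul, Ideal.Quotient.eq_zero_iff_mem, Ideal.mem_span_singleton'] at h
  obtain ⟨C, hC⟩ := h
  obtain ⟨D, hD⟩ := ps_reg hC.symm
  rw [Ideal.Quotient.eq_zero_iff_mem, Ideal.mem_span_singleton']
  exact ⟨D, hD.symm⟩

lemma R_reg2 {K : Type} [Field K] (a b : psHypersurface K)
    (h : Ideal.Quotient.mk _ (MvPowerSeries.X 0) * a =
      b * Ideal.Quotient.mk _ (MvPowerSeries.X 1)) :
    ∃ c, b = Ideal.Quotient.mk _ (MvPowerSeries.X 0) * c := by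
  obtain ⟨A, rfl⟩ := Ideal.Quotient.mk_surjective a
  obtain ⟨B, rfl⟩ := Ideal.Quotient.mk_surjective b
  rw [← map_mul, ← map_mul, Ideal.Quotient.mk_eq_mk_iff_sub_mem, Ideal.mem_span_singleton'] at h
  obtain ⟨C, hC⟩ := h
  obtain ⟨D, E, hD⟩ := ps_reg2 (A := A) (B := B) (C := C) (by linear_combination -hC)
  refine ⟨Ideal.Quotient.mk _ D, ?_⟩
  rw [← map_mul, Ideal.Quotient.mk_eq_mk_iff_sub_mem, Ideal.mem_span_singleton']
  exact ⟨E, by linear_combination -hD⟩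

section resolution
open CategoryTheory Limits
variable {R : Type} [CommRing R] {P0 P1 P2 M : Type}
  [AddCommGroup P0] [Module R P0] [AddCommGroup P1] [Module R P1]
  [AddCommGroup P2] [Module R P2] [AddCommGroup M] [Module R M]

/-- The objects of a three term complex. -/
def resX (R : Type) [CommRing R] (P0 P1 P2 : Type)
  [AddCommGroup P0] [Module R P0] [AddCommGroup P1] [Module R P1]
  [AddCommGroup P2] [Module R P2] : ℕ → ModuleCat.{0} R
  | 0 => ModuleCat.of R P0
  | 1 => ModuleCat.of R P1
  | 2 => ModuleCat.of R P2
  | _ + 3 => ModuleCat.of R PUnit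

/-- The differentials of a three term complex. -/
def resd (d1 : P1 →ₗ[R] P0) (d2 : P2 →ₗ[R] P1) :
    ∀ n, resX R P0 P1 P2 (n + 1) ⟶ resX R P0 P1 P2 n
  | 0 => ModuleCat.ofHom d1
  | 1 => ModuleCat.ofHom d2
  | _ + 2 => 0

/-- The three term complex. -/
noncomputable def resC (d1 : P1 →ₗ[R] P0) (d2 : P2 →ₗ[R] P1) (h : d1 ∘ₗ d2 = 0) :
    ChainComplex (ModuleCat.{0} R) ℕ :=
  ChainComplex.of (resX R P0 P1 P2) (resd d1 d2) (by
    intro n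
    match n with
    | 0 =>
      change ModuleCat.ofHom d2 ≫ ModuleCat.ofHom d1 = 0
      rw [← ModuleCat.ofHom_comp, h]; rfl
    | n + 1 => exact zero_comp)

variable (d1 : P1 →ₗ[R] P0) (d2 : P2 →ₗ[R] P1) (h : d1 ∘ₗ d2 = 0)

lemma resC_d (n : ℕ) : (resC d1 d2 h).d (n + 1) n = resd d1 d2 n :=
  ChainComplex.of_d _ _ _

/-- The three term resolution. -/
noncomputable def resP [Module.Projective R P0] [Module.Projective R P1] [Module.Projective R P2]
    (p : P0 →ₗ[R] M) (hp : Function.Surjective p) (e0 : Function.Exact d1 p)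
    (e1 : Function.Exact d2 d1) (e2 : Function.Injective d2) :
    ProjectiveResolution (ModuleCat.of R M) where
  complex := resC d1 d2 h
  projective n := by
    match n with
    | 0 => exact ModuleCat.projective_of_categoryTheory_projective (ModuleCat.of R P0)
    | 1 => exact ModuleCat.projective_of_categoryTheory_projective (ModuleCat.of R P1)
    | 2 => exact ModuleCat.projective_of_categoryTheory_projective (ModuleCat.of R P2)
    | n + 3 => exact ModuleCat.projective_of_categoryTheory_projective (ModuleCat.of R PUnit)
  π := (ChainComplex.toSingle₀Equiv _ _).symm ⟨ModuleCat.ofHom p, by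
    rw [resC_d]
    change ModuleCat.ofHom d1 ≫ ModuleCat.ofHom p = 0
    rw [← ModuleCat.ofHom_comp, e0.linearMap_comp_eq_zero]; rfl⟩
  quasiIso := ⟨fun n => by
    cases n with
    | zero =>
      rw [ChainComplex.quasiIsoAt₀_iff, ShortComplex.quasiIso_iff_of_zeros' _ rfl rfl rfl]
      refine (ShortComplex.exact_and_epi_g_iff_of_iso (S₂ := ShortComplex.mk (ModuleCat.ofHom d1)
        (ModuleCat.ofHom p) (by rw [← ModuleCat.ofHom_comp, e0.linearMap_comp_eq_zero]; rfl)) ?_).2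
          ⟨?_, ?_⟩
      · exact ShortComplex.isoMk (Iso.refl _) (Iso.refl _) (Iso.refl _)
          (by simp; exact (resC_d d1 d2 h 0).symm)
          (by erw [Category.id_comp])
      · exact ModuleCat.shortComplex_exact _ e0
      · exact (ModuleCat.epi_iff_surjective _).2 hp
    | succ n =>
      rw [quasiIsoAt_iff_exactAt' (hL := ChainComplex.exactAt_succ_single_obj ..),
        HomologicalComplex.exactAt_iff' _ (n + 2) (n + 1) n (by simp) (by simp)]
      apply ModuleCat.shortComplex_exact
      change Function.Exact ((resC d1 d2 h).d (n + 2) (n + 1)) ((resC d1 d2 h).d (n + 1) n)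
      rw [resC_d, resC_d]
      match n with
      | 0 => exact e1
      | 1 =>
        intro a
        constructor
        · intro ha
          exact ⟨0, (map_zero _).trans (e2 (ha.trans (map_zero d2).symm)).symm⟩
        · rintro ⟨b, rfl⟩
          exact map_zero d2
      | n + 2 =>
        intro a
        exact ⟨fun _ => ⟨0, Subsingleton.elim (α := PUnit) _ _⟩, fun _ => rfl⟩⟩

/-- Ext in degree two. -/
lemma ext_two_of_res [Module.Projective R P0] [Module.Projective R P1] [Module.Projective R P2]
    (p : P0 →ₗ[R] M) (hp : Function.Surjective p) (e0 : Function.Exact d1 p)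
    (e1 : Function.Exact d2 d1) (e2 : Function.Injective d2)
    (N : Type) [AddCommGroup N] [Module R N] (Q : Type) [AddCommGroup Q] [Module R Q]
    (q : (P2 →ₗ[R] N) →ₗ[R] Q) (hq : Function.Surjective q)
    (hker : ∀ f, q f = 0 ↔ ∃ g : P1 →ₗ[R] N, g ∘ₗ d2 = f) :
    Nonempty (extMod R 2 M N ≃ₗ[R] Q) := by
  have h : d1 ∘ₗ d2 = 0 := e1.linearMap_comp_eq_zero
  let P := resP d1 d2 h p hp e0 e1 e2
  let C := P.complex.linearYonedaObj R (ModuleCat.of R N)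
  let S := C.sc' 1 2 3
  let i1 : extMod R 2 M N ≅ S.homology := P.isoExt 2 (ModuleCat.of R N) ≪≫
    C.homologyIsoSc' 1 2 3 (by simp) (by simp)
  have hd : ∀ n, P.complex.d (n + 1) n = resd d1 d2 n := resC_d d1 d2 h
  have hg : S.g = 0 := by
    ext f
    change P.complex.d 3 2 ≫ f = 0
    rw [hd 2]
    exact zero_comp
  let e : (P2 →ₗ[R] N) ≃ₗ[R] S.X₂ :=
    (ModuleCat.homLinearEquiv (M := ModuleCat.of R P2) (N := ModuleCat.of R N) (S := R)).symm
  let e' : (P1 →ₗ[R] N) ≃ₗ[R] S.X₁ :=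
    (ModuleCat.homLinearEquiv (M := ModuleCat.of R P1) (N := ModuleCat.of R N) (S := R)).symm
  have hf : ∀ g : P1 →ₗ[R] N, S.f (e' g) = e (g ∘ₗ d2) := by
    intro g
    change P.complex.d 2 1 ≫ (ModuleCat.ofHom g : ModuleCat.of R P1 ⟶ ModuleCat.of R N) = _
    rw [hd 1]
    rfl
  let φ : S.X₂ ⟶ ModuleCat.of R Q := ModuleCat.ofHom (q ∘ₗ e.symm.toLinearMap)
  have hex : Function.Exact S.f φ := by
    intro a
    obtain ⟨a, rfl⟩ := e.surjective a
    have : φ (e a) = q a := by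
      change q (e.symm (e a)) = q a
      rw [e.symm_apply_apply]
    rw [this, hker]
    constructor
    · rintro ⟨g, rfl⟩
      exact ⟨e' g, hf g⟩
    · rintro ⟨g, hg⟩
      obtain ⟨g, rfl⟩ := e'.surjective g
      exact ⟨g, e.injective ((hf g).symm.trans hg)⟩
  have w : S.f ≫ φ = 0 := by
    ext a
    exact (hex _).2 ⟨a, rfl⟩
  let T := ShortComplex.mk S.f φ w
  have hT : T.Exact := ModuleCat.shortComplex_exact _ hex
  have : Epi T.g := (ModuleCat.epi_iff_surjective _).2 (hq.comp e.symm.surjective)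
  let L := ShortComplex.LeftHomologyData.ofIsColimitCokernelCofork S hg _ hT.gIsCokernel
  exact ⟨(i1 ≪≫ L.homologyIso).toLinearEquiv⟩
end resolution

/-- For `R = K[[X,Y,U,V]]/(XY-UV)` and `M = M'/xM'`: `Ext_R^2(M, R) ≅ K`,
the residue field `R/(x,y,u,v)` of `R`. -/
theorem ext_two_Mmod_iso_residue (K : Type) [Field K]
    (x y u v : psHypersurface K)
    (hx : x = Ideal.Quotient.mk _ (MvPowerSeries.X 0))
    (hy : y = Ideal.Quotient.mk _ (MvPowerSeries.X 1))
    (hu : u = Ideal.Quotient.mk _ (MvPowerSeries.X 2))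
    (hv : v = Ideal.Quotient.mk _ (MvPowerSeries.X 3)) :
    Nonempty ((extMod (psHypersurface K) 2 (Mmod K x y u v) (psHypersurface K))
      ≃ₗ[psHypersurface K] (psHypersurface K ⧸ Ideal.span {x, y, u, v})) := by
  let R := psHypersurface K
  let w : Fin 4 → R := ![x, y, u, v]
  let d1 : ((Fin 4 → R) × R) →ₗ[R] (Fin 4 → R) :=
    LinearMap.coprod (x • LinearMap.id) (LinearMap.toSpanSingleton R _ w)
  let d2 : R →ₗ[R] ((Fin 4 → R) × R) :=
    LinearMap.prod (LinearMap.toSpanSingleton R _ w) (LinearMap.toSpanSingleton R R (-x))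
  have hd1 : ∀ a b, d1 (a, b) = x • a + b • w := fun a b => rfl
  have hd2 : ∀ c, d2 c = (c • w, c * (-x)) := fun c => rfl
  let p : (Fin 4 → R) →ₗ[R] Mmod K x y u v :=
    (Submodule.mkQ _) ∘ₗ (Submodule.mkQ _)
  have hp : Function.Surjective p :=
    (Submodule.mkQ_surjective _).comp (Submodule.mkQ_surjective _)
  have e0 : Function.Exact d1 p := by
    intro a
    change Submodule.mkQ _ (Submodule.mkQ _ a) = 0 ↔ _
    rw [Submodule.mkQ_apply, Submodule.Quotient.mk_eq_zero, Submodule.ideal_span_singleton_smul,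
      Submodule.mem_smul_pointwise_iff_exists]
    constructor
    · rintro ⟨b, -, hb⟩
      obtain ⟨b, rfl⟩ := Submodule.mkQ_surjective _ b
      rw [← map_smul, Submodule.mkQ_apply, Submodule.mkQ_apply, eq_comm, Submodule.Quotient.eq,
        Submodule.mem_span_singleton] at hb
      obtain ⟨c, hc⟩ := hb
      refine ⟨(b, c), ?_⟩
      rw [hd1]
      change _ + c • ![x, y, u, v] = _
      rw [hc]; abel
    · rintro ⟨⟨b, c⟩, rfl⟩
      refine ⟨Submodule.mkQ _ b, trivial, ?_⟩
      rw [hd1, ← map_smul, Submodule.mkQ_apply, Submodule.mkQ_apply, eq_comm,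
        Submodule.Quotient.eq, Submodule.mem_span_singleton]
      refine ⟨c, ?_⟩
      change c • w = _
      abel
  have reg : ∀ a : R, x * a = 0 → a = 0 := by
    subst hx; exact R_reg
  have reg2 : ∀ a b : R, x * a = b * y → ∃ c, b = x * c := by
    subst hx hy; exact R_reg2
  have e1 : Function.Exact d2 d1 := by
    rintro ⟨a, b⟩
    rw [hd1]
    constructor
    · intro h
      have h0 : x * a 0 + b * x = 0 := congrFun h 0
      have h1 : x * a 1 + b * y = 0 := congrFun h 1
      obtain ⟨c, hc⟩ := reg2 (-a 1) b (by linear_combination -h1)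
      refine ⟨-c, ?_⟩
      rw [hd2]
      refine Prod.ext ?_ ?_
      · have h' : a + c • w = 0 := by
          funext i
          apply reg
          have := congrFun h i
          simp only [Pi.add_apply, Pi.smul_apply, smul_eq_mul, Pi.zero_apply] at this ⊢
          rw [hc] at this
          linear_combination this
        change -c • w = a
        rw [neg_smul]
        exact (eq_neg_of_add_eq_zero_left h').symm
      · change -c * -x = b
        rw [hc]; ring
    · rintro ⟨c, hc⟩
      rw [hd2] at hc
      obtain ⟨rfl, rfl⟩ := Prod.mk.inj hc
      rw [smul_smul, ← add_smul]
      have : x * c + c * -x = 0 := by ring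
      rw [this]
      exact zero_smul R w
  have e2 : Function.Injective d2 := by
    rw [injective_iff_map_eq_zero]
    intro c hc
    have : c * -x = 0 := congrArg Prod.snd hc
    exact reg c (by linear_combination -this)
  let q : (R →ₗ[R] R) →ₗ[R] (R ⧸ Ideal.span {x, y, u, v}) :=
    (Submodule.mkQ _) ∘ₗ (LinearMap.applyₗ (1 : R))
  have hq : ∀ f, q f = Ideal.Quotient.mk _ (f 1) := fun f => rfl
  refine ext_two_of_res d1 d2 p hp e0 e1 e2 R _ q ?_ ?_
  · intro a
    obtain ⟨a, rfl⟩ := Ideal.Quotient.mk_surjective a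
    refine ⟨LinearMap.toSpanSingleton R R a, ?_⟩
    rw [hq, LinearMap.toSpanSingleton_apply, one_smul]
  · intro f
    rw [hq, Ideal.Quotient.eq_zero_iff_mem]
    constructor
    · intro hf
      simp only [Ideal.mem_span_insert, Ideal.mem_span_singleton'] at hf
      obtain ⟨a, _, ⟨b, _, ⟨c, _, ⟨d, rfl⟩, rfl⟩, rfl⟩, hf⟩ := hf
      refine ⟨LinearMap.coprod (Fintype.linearCombination R ![a, b, c, d]) 0, ?_⟩
      apply LinearMap.ext_ring
      rw [hf]
      change Fintype.linearCombination R ![a, b, c, d] ((1 : R) • w) + 0 = _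
      rw [one_smul, Fintype.linearCombination_apply, Fin.sum_univ_four]
      change x * a + y * b + u * c + v * d + 0 = _
      ring
    · rintro ⟨g, rfl⟩
      change g ((1 : R) • w, 1 * -x) ∈ _
      have hw : ((1 : R) • w, 1 * -x) = x • (Pi.single 0 1, (0 : R)) + y • (Pi.single 1 1, (0 : R))
          + u • (Pi.single 2 1, (0 : R)) + v • (Pi.single 3 1, (0 : R)) + x • (0, -1) := by
        refine Prod.ext ?_ ?_
        · funext i
          fin_cases i <;> simp [w]
        · simp
          exact (mul_neg_one x).symm
      rw [hw]
      simp only [map_add, map_smul, smul_eq_mul]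
      have hx' : x ∈ Ideal.span {x, y, u, v} := Ideal.subset_span (by simp)
      have hy' : y ∈ Ideal.span {x, y, u, v} := Ideal.subset_span (by simp)
      have hu' : u ∈ Ideal.span {x, y, u, v} := Ideal.subset_span (by simp)
      have hv' : v ∈ Ideal.span {x, y, u, v} := Ideal.subset_span (by simp)
      exact add_mem (add_mem (add_mem (add_mem (Ideal.mul_mem_right _ _ hx')
        (Ideal.mul_mem_right _ _ hy')) (Ideal.mul_mem_right _ _ hu'))
        (Ideal.mul_mem_right _ _ hv')) (Ideal.mul_mem_right _ _ hx')
end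

section
/- Let A be a Noetherian local ring, x, y an A-regular sequence, set Ā = A/xA, and let M be a finitely generated A-module with ℓ(M ⊗_A A/(x,y)) < ∞. Then ℓ(Tor_1^A(M, A/(x,y))) ≤ ℓ(Tor_1^{Ā}(M ⊗_A Ā, Ā/yĀ)) + ℓ(Tor_1^A(M, Ā) ⊗_A A/(x,y)). -/
open CategoryTheory

open scoped TensorProduct

section Cat
open CategoryTheory.Limits
variable {C : Type*} [Category C] [Abelian C] [EnoughProjectives C]

theorem bcD {X Y : C} (f : X ⟶ Y) : Projective.d f ≫ f = 0 := by
  exact (Category.assoc (Projective.π (kernel f)) (kernel.ι f) f).trans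
    ((congrArg _ (kernel.condition f)).trans comp_zero)

noncomputable def bcComplex {X₀ X₁ X₂ : C} (d₀ : X₁ ⟶ X₀) (d₁ : X₂ ⟶ X₁) (s : d₁ ≫ d₀ = 0) :
    ChainComplex C ℕ :=
  ChainComplex.mk X₀ X₁ X₂ d₀ d₁ s (fun S => ⟨Projective.syzygies S.f, Projective.d S.f, bcD S.f⟩)

theorem bcComplex_exactAt {X₀ X₁ X₂ : C} (d₀ : X₁ ⟶ X₀) (d₁ : X₂ ⟶ X₁) (s : d₁ ≫ d₀ = 0)
    (hex : (ShortComplex.mk d₁ d₀ s).Exact) (n : ℕ) : (bcComplex d₀ d₁ s).ExactAt (n + 1) := by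
  rw [HomologicalComplex.exactAt_iff' _ (n + 1 + 1) (n + 1) n (by simp) (by simp)]
  have e := ChainComplex.mkAux_eq_shortComplex_mk_d_comp_d X₀ X₁ X₂ d₀ d₁ s
    (fun S => ⟨Projective.syzygies S.f, Projective.d S.f, bcD S.f⟩) n
  have : (ChainComplex.mkAux X₀ X₁ X₂ d₀ d₁ s
    (fun S => ⟨Projective.syzygies S.f, Projective.d S.f, bcD S.f⟩) n).Exact := by
    match n with
    | 0 => exact hex
    | n + 1 => exact CategoryTheory.exact_d_f _
  rw [e] at this
  exact this

theorem bcComplex_projective {X₀ X₁ X₂ : C} [Projective X₀] [Projective X₁] [Projective X₂]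
    (d₀ : X₁ ⟶ X₀) (d₁ : X₂ ⟶ X₁) (s : d₁ ≫ d₀ = 0) (n : ℕ) :
    Projective ((bcComplex d₀ d₁ s).X n) := by
  match n with
  | 0 => exact (inferInstance : Projective X₀)
  | 1 => exact (inferInstance : Projective X₁)
  | 2 => exact (inferInstance : Projective X₂)
  | n + 3 => exact Projective.projective_over _

noncomputable def bcResolution {X₀ X₁ X₂ N : C} [Projective X₀] [Projective X₁] [Projective X₂]
    (d₀ : X₁ ⟶ X₀) (d₁ : X₂ ⟶ X₁) (s : d₁ ≫ d₀ = 0)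
    (hex : (ShortComplex.mk d₁ d₀ s).Exact) (p : X₀ ⟶ N) (s' : d₀ ≫ p = 0)
    (hex' : (ShortComplex.mk d₀ p s').Exact) (hp : Epi p) : ProjectiveResolution N where
  complex := bcComplex d₀ d₁ s
  projective := bcComplex_projective d₀ d₁ s
  π := (ChainComplex.toSingle₀Equiv _ _).symm ⟨p, by
    have : (bcComplex d₀ d₁ s).d 1 0 = d₀ := ChainComplex.mk_d_1_0 ..
    exact (congrArg (· ≫ p) this).trans s'⟩
  quasiIso := ⟨fun n => by
    cases n
    · rw [ChainComplex.quasiIsoAt₀_iff, ShortComplex.quasiIso_iff_of_zeros']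
      · have : (bcComplex d₀ d₁ s).d 1 0 = d₀ := ChainComplex.mk_d_1_0 ..
        refine (ShortComplex.exact_and_epi_g_iff_of_iso ?_).2 ⟨hex', hp⟩
        refine ShortComplex.isoMk (Iso.refl _) (Iso.refl _) (Iso.refl _) ?_ ?_
        · refine (Category.id_comp _).trans (Eq.trans ?_ (Category.comp_id _).symm)
          exact this.symm
        · refine (Category.id_comp _).trans (Eq.trans ?_ (Category.comp_id _).symm)
          exact (ChainComplex.toSingle₀Equiv_symm_apply_f_zero (C := bcComplex d₀ d₁ s) p _).symm
      all_goals rfl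
    · rw [quasiIsoAt_iff_exactAt']
      · exact bcComplex_exactAt _ _ _ hex _
      · apply ChainComplex.exactAt_succ_single_obj⟩

noncomputable def bcIso {D : Type*} [Category D] [Abelian D] (F : C ⥤ D) [F.Additive]
    {X₀ X₁ X₂ N : C} [Projective X₀] [Projective X₁] [Projective X₂]
    (d₀ : X₁ ⟶ X₀) (d₁ : X₂ ⟶ X₁) (s : d₁ ≫ d₀ = 0)
    (hex : (ShortComplex.mk d₁ d₀ s).Exact) (p : X₀ ⟶ N) (s' : d₀ ≫ p = 0)
    (hex' : (ShortComplex.mk d₀ p s').Exact) (hp : Epi p) :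
    (F.leftDerived 1).obj N ≅ (ShortComplex.mk (F.map d₁) (F.map d₀)
      (by rw [← F.map_comp, s, F.map_zero])).homology := by
  refine (bcResolution d₀ d₁ s hex p s' hex' hp).isoLeftDerivedObj F 1 ≪≫
    HomologicalComplex.homologyIsoSc' _ 2 1 0 (by simp) (by simp) ≪≫
    ShortComplex.homologyMapIso (ShortComplex.isoMk (Iso.refl (F.obj X₂)) (Iso.refl (F.obj X₁))
      (Iso.refl (F.obj X₀)) ?_ ?_)
  · refine (Category.id_comp _).trans (Eq.trans ?_ (Category.comp_id _).symm)
    exact congrArg F.map (ChainComplex.mk_d_2_1 ..).symm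
  · refine (Category.id_comp _).trans (Eq.trans ?_ (Category.comp_id _).symm)
    exact congrArg F.map (ChainComplex.mk_d_1_0 ..).symm
end Cat

theorem bcTor (R : Type) [CommRing R] (M N P₀ P₁ P₂ B₀ B₁ B₂ : Type)
    [AddCommGroup M] [Module R M] [AddCommGroup N] [Module R N]
    [AddCommGroup P₀] [Module R P₀] [AddCommGroup P₁] [Module R P₁] [AddCommGroup P₂] [Module R P₂]
    [AddCommGroup B₀] [Module R B₀] [AddCommGroup B₁] [Module R B₁] [AddCommGroup B₂] [Module R B₂]
    [Module.Projective R P₀] [Module.Projective R P₁] [Module.Projective R P₂]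
    (d₀ : P₁ →ₗ[R] P₀) (d₁ : P₂ →ₗ[R] P₁) (p : P₀ →ₗ[R] N)
    (h₁ : Function.Exact d₁ d₀) (h₀ : Function.Exact d₀ p) (hp : Function.Surjective p)
    (e₀ : TensorProduct R M P₀ ≃ₗ[R] B₀) (e₁ : TensorProduct R M P₁ ≃ₗ[R] B₁)
    (e₂ : TensorProduct R M P₂ ≃ₗ[R] B₂) (f : B₂ →ₗ[R] B₁) (g : B₁ →ₗ[R] B₀)
    (hf : ∀ z, f (e₂ z) = e₁ (d₁.lTensor M z)) (hg : ∀ z, g (e₁ z) = e₀ (d₀.lTensor M z)) :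
    ∃ π : LinearMap.ker g →ₗ[R] torMod R 1 M N, Function.Surjective π ∧
      ∀ z, π z = 0 ↔ (z : B₁) ∈ LinearMap.range f := by
  have : Projective (ModuleCat.of R P₀) := inferInstance
  have s : ModuleCat.ofHom d₁ ≫ ModuleCat.ofHom d₀ = 0 := by
    ext z; exact h₁.apply_apply_eq_zero z
  have s' : ModuleCat.ofHom d₀ ≫ ModuleCat.ofHom p = 0 := by
    ext z; exact h₀.apply_apply_eq_zero z
  let i := bcIso ((MonoidalCategory.tensoringLeft (ModuleCat R)).obj (ModuleCat.of R M))
    (ModuleCat.ofHom d₀) (ModuleCat.ofHom d₁) s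
    ((ShortComplex.ShortExact.moduleCat_exact_iff_function_exact _).2 h₁) (ModuleCat.ofHom p) s'
    ((ShortComplex.ShortExact.moduleCat_exact_iff_function_exact _).2 h₀)
    ((ModuleCat.epi_iff_surjective _).2 hp)
  let j := (i ≪≫ ShortComplex.moduleCatHomologyIso _).toLinearEquiv
  let c : LinearMap.ker g →ₗ[R] LinearMap.ker (d₀.lTensor M) :=
    (e₁.symm.toLinearMap ∘ₗ (LinearMap.ker g).subtype).codRestrict _ (fun z => by
      have := hg (e₁.symm z)
      simp at this
      simpa using this.symm)
  have hc : Function.Surjective c := fun z => ⟨⟨e₁ z, by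
      have := hg z
      simpa using this⟩, by ext; simp [c]⟩
  let dd : TensorProduct R M P₂ →ₗ[R] LinearMap.ker (d₀.lTensor M) :=
    (d₁.lTensor M).codRestrict _ (fun z => by
      have : d₀.comp d₁ = 0 := by ext z; exact h₁.apply_apply_eq_zero z
      simp [← LinearMap.lTensor_comp_apply, this])
  let q : (LinearMap.ker (d₀.lTensor M) ⧸ LinearMap.range dd) ≃ₗ[R] torMod R 1 M N := j.symm
  refine ⟨q.toLinearMap ∘ₗ (Submodule.mkQ _) ∘ₗ c, ?_, ?_⟩
  · exact q.surjective.comp ((Submodule.mkQ_surjective _).comp hc)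
  · intro z
    simp only [LinearMap.comp_apply, LinearEquiv.coe_coe, LinearEquiv.map_eq_zero_iff,
      Submodule.mkQ_apply, Submodule.Quotient.mk_eq_zero]
    constructor
    · rintro ⟨w, hw⟩
      refine ⟨e₂ w, ?_⟩
      rw [hf]
      have := congrArg (fun t => e₁ t.1) hw
      simpa [dd, c] using this
    · rintro ⟨w, hw⟩
      refine ⟨e₂.symm w, ?_⟩
      ext
      have := hf (e₂.symm w)
      simp [dd, c, ← hw]
      simp at this
      simp [this]

theorem bcTorRegular (R : Type) [CommRing R] (r : R) (hr : IsSMulRegular R r)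
    (M : Type) [AddCommGroup M] [Module R M] :
    Nonempty (LinearMap.ker (LinearMap.lsmul R M r) ≃ₗ[R] torMod R 1 M (R ⧸ Ideal.span {r})) := by
  obtain ⟨π, hs, hk⟩ := bcTor R M (R ⧸ Ideal.span {r}) R R PUnit M M (TensorProduct R M PUnit)
    (LinearMap.lsmul R R r) 0 (Submodule.mkQ _)
    (by
      intro z
      constructor
      · intro h
        exact ⟨0, (hr (by simpa using h)).symm⟩
      · rintro ⟨w, rfl⟩
        simp)
    (by
      intro z
      simp only [Submodule.mkQ_apply, Submodule.Quotient.mk_eq_zero, Ideal.mem_span_singleton']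
      simp [mul_comm])
    (Submodule.mkQ_surjective _)
    (TensorProduct.rid R M) (TensorProduct.rid R M) (LinearEquiv.refl R _) 0
    (LinearMap.lsmul R M r)
    (by simp)
    (by
      intro z
      induction z with
      | zero => simp
      | add a b ha hb => simp only [map_add, ha, hb]
      | tmul m a => simp [mul_smul, smul_comm a r])
  refine ⟨LinearEquiv.ofBijective π ⟨?_, hs⟩⟩
  rw [← LinearMap.ker_eq_bot, eq_bot_iff]
  intro z hz
  have := (hk z).1 hz
  simpa using this

theorem bcLengthRegular (A R : Type) [CommRing A] [CommRing R] [Algebra A R] (r : R)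
    (hr : IsSMulRegular R r) (hs : Function.Surjective (algebraMap A R))
    (M : Type) [AddCommGroup M] [Module R M] [Module A M] [IsScalarTower A R M] :
    Module.length A ((LinearMap.ker (LinearMap.lsmul R M r)).restrictScalars A) =
      Module.length R (torMod R 1 M (R ⧸ Ideal.span {r})) := by
  obtain ⟨e⟩ := bcTorRegular R r hr M
  rw [← e.length_eq, ← Module.length_eq_of_surjective (S := A) hs]
  rfl

theorem bcTorKoszul (A : Type) [CommRing A] (x y : A)
    (hx : IsSMulRegular A x)
    (hy : IsSMulRegular (A ⧸ Ideal.span {x}) y)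
    (M : Type) [AddCommGroup M] [Module A M] :
    ∃ π : LinearMap.ker ((LinearMap.lsmul A M x).coprod (LinearMap.lsmul A M y)) →ₗ[A]
        torMod A 1 M (A ⧸ Ideal.span ({x, y} : Set A)), Function.Surjective π ∧
      ∀ z, π z = 0 ↔ ∃ m : M, (-(y • m), x • m) = (z : M × M) := by
  obtain ⟨π, hs, hk⟩ := bcTor A M (A ⧸ Ideal.span ({x, y} : Set A)) A (A × A) A M (M × M) M
    ((LinearMap.lsmul A A x).coprod (LinearMap.lsmul A A y))
    ((-(LinearMap.lsmul A A y)).prod (LinearMap.lsmul A A x))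
    (Submodule.mkQ _)
    (by
      rintro ⟨a, b⟩
      constructor
      · intro h
        have h : x * a + y * b = 0 := by simpa using h
        have hb : (Ideal.Quotient.mk (Ideal.span {x}) b) = 0 := by
          apply hy
          have : y • (Ideal.Quotient.mk (Ideal.span {x}) b)
            = Ideal.Quotient.mk (Ideal.span {x}) (y * b) := rfl
          simp only [this, smul_zero]
          rw [Ideal.Quotient.eq_zero_iff_mem, Ideal.mem_span_singleton']
          exact ⟨-a, by linear_combination -h⟩
        rw [Ideal.Quotient.eq_zero_iff_mem, Ideal.mem_span_singleton'] at hb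
        obtain ⟨c, rfl⟩ := hb
        refine ⟨c, ?_⟩
        have : -(y * c) = a := by
          apply hx
          simp only [smul_eq_mul]
          linear_combination -h
        simp [this, mul_comm]
      · rintro ⟨w, hw⟩
        rw [← hw]
        simp
        ring)
    (by
      intro z
      simp only [Submodule.mkQ_apply, Submodule.Quotient.mk_eq_zero, Ideal.mem_span_pair]
      constructor
      · rintro ⟨a, b, h⟩
        exact ⟨(a, b), by simp [← h, mul_comm]⟩
      · rintro ⟨⟨a, b⟩, h⟩
        exact ⟨a, b, by simp [← h, mul_comm]⟩)
    (Submodule.mkQ_surjective _)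
    (TensorProduct.rid A M)
    (TensorProduct.prodRight A A M A A ≪≫ₗ
      (TensorProduct.rid A M).prodCongr (TensorProduct.rid A M))
    (TensorProduct.rid A M)
    ((-(LinearMap.lsmul A M y)).prod (LinearMap.lsmul A M x))
    ((LinearMap.lsmul A M x).coprod (LinearMap.lsmul A M y))
    (by
      intro z
      induction z with
      | zero => simp
      | add a b ha hb => simp only [map_add, ha, hb]
      | tmul m a => simp [mul_smul, smul_comm a x, smul_comm a y])
    (by
      intro z
      induction z with
      | zero => simp
      | add a b ha hb => simp only [map_add, ha, hb]
      | tmul m a => simp [mul_smul, add_smul, smul_comm a.1 x, smul_comm a.2 y])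
  refine ⟨π, hs, fun z => (hk z).trans ?_⟩
  simp [LinearMap.mem_range]

theorem bcLength (A : Type) [CommRing A] (I : Ideal A) (N T Q : Type)
    [AddCommGroup N] [Module A N] [AddCommGroup T] [Module A T] [AddCommGroup Q] [Module A Q]
    (ψ : N →ₗ[A] T) (φ : T →ₗ[A] Q) (L : Submodule A Q)
    (hk : LinearMap.ker φ ≤ LinearMap.range ψ) (hI : I • (⊤ : Submodule A N) ≤ LinearMap.ker ψ)
    (hL : LinearMap.range φ ≤ L) :
    Module.length A T ≤ Module.length A L + Module.length A (TensorProduct A N (A ⧸ I)) := by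
  rw [Module.length_eq_add_of_exact (LinearMap.ker φ).subtype φ.rangeRestrict
    (Submodule.subtype_injective _) φ.surjective_rangeRestrict
    (by intro z; simp [Subtype.ext_iff]), add_comm]
  refine add_le_add (Module.length_le_of_injective _ (Submodule.inclusion_injective hL)) ?_
  refine (Module.length_le_of_injective _ (Submodule.inclusion_injective hk)).trans ?_
  rw [(TensorProduct.tensorQuotEquivQuotSMul N I).length_eq]
  refine Module.length_le_of_surjective
    ((I • (⊤ : Submodule A N)).liftQ ψ.rangeRestrict (by simpa using hI)) ?_
  intro t
  obtain ⟨n, rfl⟩ := ψ.surjective_rangeRestrict t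
  exact ⟨Submodule.Quotient.mk n, by simp⟩

theorem bcTmul (A : Type) [CommRing A] (x : A) (M : Type) [AddCommGroup M] [Module A M] (b : M) :
    (1 : A ⧸ Ideal.span {x}) ⊗ₜ[A] b = 0 ↔ ∃ m : M, x • m = b := by
  rw [← (TensorProduct.quotTensorEquivQuotSMul M (Ideal.span {x})).map_eq_zero_iff]
  have := TensorProduct.quotTensorEquivQuotSMul_mk_tmul (M := M) (Ideal.span {x}) 1 b
  rw [map_one] at this
  rw [this, one_smul, Submodule.Quotient.mk_eq_zero, Submodule.ideal_span_singleton_smul,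
    Submodule.mem_smul_pointwise_iff_exists]
  simp

theorem bcMain
    (A : Type) [CommRing A] (x y : A)
    (hx : IsSMulRegular A x)
    (hy : IsSMulRegular (A ⧸ Ideal.span {x}) y)
    (M : Type) [AddCommGroup M] [Module A M] :
    Module.length A (torMod A 1 M (A ⧸ Ideal.span ({x, y} : Set A)))
      ≤ Module.length (A ⧸ Ideal.span {x})
          (torMod (A ⧸ Ideal.span {x}) 1
            (TensorProduct A (A ⧸ Ideal.span {x}) M)
            ((A ⧸ Ideal.span {x}) ⧸
              Ideal.span {(Ideal.Quotient.mk (Ideal.span {x}) y)}))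
        + Module.length A
            (TensorProduct A (torMod A 1 M (A ⧸ Ideal.span {x}))
              (A ⧸ Ideal.span ({x, y} : Set A))) := by
  obtain ⟨π, hs, hk⟩ := bcTorKoszul A x y hx hy M
  obtain ⟨e⟩ := bcTorRegular A x hx M
  have h1 := bcLengthRegular A (A ⧸ Ideal.span {x}) (Ideal.Quotient.mk (Ideal.span {x}) y)
    (fun a b h => hy h) Ideal.Quotient.mk_surjective (TensorProduct A (A ⧸ Ideal.span {x}) M)
  rw [← h1]
  have hq : Function.Surjective (π.quotKerEquivOfSurjective hs) :=
    (π.quotKerEquivOfSurjective hs).surjective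
  rw [← (π.quotKerEquivOfSurjective hs).length_eq]
  let φ₀ : LinearMap.ker ((LinearMap.lsmul A M x).coprod (LinearMap.lsmul A M y)) →ₗ[A]
      TensorProduct A (A ⧸ Ideal.span {x}) M :=
    TensorProduct.mk A (A ⧸ Ideal.span {x}) M 1 ∘ₗ LinearMap.snd A M M ∘ₗ Submodule.subtype _
  have hφ₀ : ∀ z, φ₀ z = 1 ⊗ₜ[A] z.1.2 := fun z => rfl
  let ψ₀ : LinearMap.ker (LinearMap.lsmul A M x) →ₗ[A]
      LinearMap.ker ((LinearMap.lsmul A M x).coprod (LinearMap.lsmul A M y)) :=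
    (LinearMap.inl A M M ∘ₗ Submodule.subtype _).codRestrict _ (by
      rintro ⟨z, hz⟩
      simpa using hz)
  have hψ₀ : ∀ z, (ψ₀ z).1 = (z.1, 0) := fun z => rfl
  refine bcLength A _ _ _ (TensorProduct A (A ⧸ Ideal.span {x}) M)
    ((Submodule.mkQ (LinearMap.ker π)) ∘ₗ ψ₀ ∘ₗ e.symm.toLinearMap)
    ((LinearMap.ker π).liftQ φ₀ ?_)
    ((LinearMap.ker (LinearMap.lsmul (A ⧸ Ideal.span {x})
      (TensorProduct A (A ⧸ Ideal.span {x}) M)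
        (Ideal.Quotient.mk (Ideal.span {x}) y))).restrictScalars A) ?_ ?_ ?_
  · intro z hz
    obtain ⟨m, hm⟩ := (hk z).1 hz
    rw [LinearMap.mem_ker, hφ₀, bcTmul]
    exact ⟨m, by rw [← hm]⟩
  · intro t ht
    obtain ⟨z, rfl⟩ := Submodule.mkQ_surjective _ t
    have ht : φ₀ z = 0 := by simpa using ht
    rw [hφ₀, bcTmul] at ht
    obtain ⟨m, hm⟩ := ht
    have hz : x • z.1.1 + y • z.1.2 = 0 := z.2
    refine ⟨e ⟨z.1.1 + y • m, ?_⟩, ?_⟩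
    · simp only [LinearMap.mem_ker, LinearMap.lsmul_apply, smul_add]
      rw [← hz, ← hm, smul_comm]
    · simp only [LinearMap.comp_apply, LinearEquiv.coe_coe, LinearEquiv.symm_apply_apply]
      rw [← sub_eq_zero, ← map_sub, Submodule.mkQ_apply, Submodule.Quotient.mk_eq_zero,
        LinearMap.mem_ker, hk]
      refine ⟨-m, ?_⟩
      rw [Submodule.coe_sub, hψ₀]
      ext <;> simp [hm]
  · rw [Submodule.smul_le]
    intro r hr n _
    rw [LinearMap.mem_ker, map_smul]
    simp only [LinearMap.comp_apply, LinearEquiv.coe_coe]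
    rw [← map_smul, Submodule.mkQ_apply, Submodule.Quotient.mk_eq_zero,
        LinearMap.mem_ker, hk]
    obtain ⟨a, b, rfl⟩ := Ideal.mem_span_pair.1 hr
    have hn : x • (e.symm n).1 = 0 := (e.symm n).2
    refine ⟨-(b • (e.symm n).1), ?_⟩
    rw [Submodule.coe_smul, hψ₀]
    ext
    · simp [add_smul, mul_smul, hn, smul_comm y b]
    · simp [smul_comm x b, hn]
  · rintro _ ⟨t, rfl⟩
    obtain ⟨z, rfl⟩ := Submodule.mkQ_surjective _ t
    have hz : x • z.1.1 + y • z.1.2 = 0 := z.2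
    change Ideal.Quotient.mk (Ideal.span {x}) y • φ₀ z = 0
    have : Ideal.Quotient.mk (Ideal.span {x}) y • φ₀ z = y • φ₀ z :=
      algebraMap_smul (A ⧸ Ideal.span {x}) y (φ₀ z)
    rw [this, hφ₀, ← TensorProduct.tmul_smul, bcTmul]
    exact ⟨-z.1.1, by rw [smul_neg, neg_eq_iff_add_eq_zero, hz]⟩

/-- For an `A`-regular sequence `x, y`, `Ā = A/xA`, and a finitely generated `A`-module `M`
with `ℓ(M ⊗ A/(x,y)) < ∞`:
`ℓ(Tor_1^A(M, A/(x,y))) ≤ ℓ(Tor_1^Ā(M ⊗ Ā, Ā/yĀ)) + ℓ(Tor_1^A(M, Ā) ⊗ A/(x,y))`. -/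
theorem length_tor_one_le_base_change
    (A : Type) [CommRing A] [IsNoetherianRing A] [IsLocalRing A]
    (x y : A)
    (hx : IsSMulRegular A x)
    (hy : IsSMulRegular (A ⧸ Ideal.span {x}) y)
    (M : Type) [AddCommGroup M] [Module A M] [Module.Finite A M]
    (hlen : moduleLength A (TensorProduct A M (A ⧸ Ideal.span ({x, y} : Set A))) < ⊤) :
    moduleLength A (torMod A 1 M (A ⧸ Ideal.span ({x, y} : Set A)))
      ≤ moduleLength (A ⧸ Ideal.span {x})
          (torMod (A ⧸ Ideal.span {x}) 1
            (TensorProduct A (A ⧸ Ideal.span {x}) M)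
            ((A ⧸ Ideal.span {x}) ⧸
              Ideal.span {(Ideal.Quotient.mk (Ideal.span {x}) y)}))
        + moduleLength A
            (TensorProduct A (torMod A 1 M (A ⧸ Ideal.span {x}))
              (A ⧸ Ideal.span ({x, y} : Set A))) := by
  have h := bcMain A x y hx hy M
  unfold moduleLength
  rw [← Module.coe_length, ← Module.coe_length, ← Module.coe_length]
  exact_mod_cast h
end

section
/- Let K be a field of characteristic p > 0, t ≥ 1, q = p^n, and R = K[X_1,...,X_t,Y_1,...,Y_t]/(Σ_{i=1}^t X_i Y_i) with maximal ideal m generated by the images of all the variables. Then the socle of R/m^{[q]}, where m^{[q]} is generated by the q-th powers of the variable images, has K-dimension at least q (for t ≥ 2); in particular dim_K Hom_R(R/m, R/m^{[q]}) is unbounded as n → ∞. -/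
open MvPolynomial

/-- `R = K[X_1,...,X_t,Y_1,...,Y_t]/(Σ X_i Y_i)`. -/
noncomputable abbrev genHypersurface (K : Type) [Field K] (t : ℕ) : Type :=
  MvPolynomial (Fin t ⊕ Fin t) K ⧸
    Ideal.span {∑ i : Fin t, (X (Sum.inl i) : MvPolynomial (Fin t ⊕ Fin t) K) * X (Sum.inr i)}

/-- `R/m^{[q]}`, the quotient by the ideal generated by `q`-th powers of the variables. -/
noncomputable abbrev genFrobPower (K : Type) [Field K] (t q : ℕ) : Type :=
  genHypersurface K t ⧸
    Ideal.span (Set.range fun i : Fin t ⊕ Fin t =>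
      (Ideal.Quotient.mk _ (X i) : genHypersurface K t) ^ q)

/-- The socle of `R/m^{[q]}` as a `K`-subspace: elements killed by every variable. -/
noncomputable abbrev genSocle (K : Type) [Field K] (t q : ℕ) :
    Submodule K (genFrobPower K t q) :=
  ⨅ i : Fin t ⊕ Fin t,
    LinearMap.ker (LinearMap.mulLeft K
      ((Ideal.Quotient.mk _ ((Ideal.Quotient.mk _ (X i) : genHypersurface K t))) :
        genFrobPower K t q))

section kill

variable {S : Type} [CommRing S]

theorem gs_pow_transfer (c d P : S) (h : (c + d) * P = 0) (k : ℕ) : c ^ k * P = (-d) ^ k * P := by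
  induction k with
  | zero => simp
  | succ k ih =>
    have h1 : c * P = -d * P := by linear_combination h
    rw [pow_succ, pow_succ]
    linear_combination c * ih + (-d) ^ k * h1

/-- multiplication by `V` -/
theorem gs_killV (U V A B P : S) (q b : ℕ) (hb : b + 1 < q) (hA : A ^ q = 0)
    (h : (U * V + A * B) * P = 0) : V * (U ^ (q - 1) * V ^ b * A ^ (q - 1 - b) * P) = 0 := by
  obtain ⟨k, rfl⟩ : ∃ k, q = b + 1 + 1 + k := ⟨q - (b + 2), by omega⟩
  have e1 : b + 1 + 1 + k - 1 = b + 1 + k := by omega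
  have e2 : b + 1 + 1 + k - 1 - b = k + 1 := by omega
  rw [e2, e1]
  have h1 := gs_pow_transfer _ _ _ h (b + 1)
  have h2 : (-(A * B)) ^ (b + 1) = (-B) ^ (b + 1) * A ^ (b + 1) := by rw [← mul_pow]; ring
  rw [h2] at h1
  calc _ = U ^ k * A ^ (k + 1) * ((U * V) ^ (b + 1) * P) := by ring
    _ = U ^ k * (-B) ^ (b + 1) * P * A ^ (b + 1 + 1 + k) := by rw [h1]; ring
    _ = 0 := by rw [hA]; ring

theorem gs_killA (U V A B P : S) (q b : ℕ) (hb : b + 1 < q) (hA : A ^ q = 0)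
    (h : (U * V + A * B) * P = 0) : A * (U ^ (q - 1) * V ^ b * A ^ (q - 1 - b) * P) = 0 := by
  obtain ⟨k, rfl⟩ : ∃ k, q = b + 1 + 1 + k := ⟨q - (b + 2), by omega⟩
  have e1 : b + 1 + 1 + k - 1 = b + 1 + k := by omega
  have e2 : b + 1 + 1 + k - 1 - b = k + 1 := by omega
  rw [e2, e1]
  have h1 := gs_pow_transfer _ _ _ h b
  have h2 : (-(A * B)) ^ b = (-B) ^ b * A ^ b := by rw [← mul_pow]; ring
  rw [h2] at h1
  calc _ = U ^ (k + 1) * A ^ (k + 2) * ((U * V) ^ b * P) := by ring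
    _ = U ^ (k + 1) * (-B) ^ b * P * A ^ (b + 1 + 1 + k) := by rw [h1]; ring
    _ = 0 := by rw [hA]; ring

theorem gs_killB (U V A B P : S) (q b : ℕ) (hb : b + 1 < q) (hU : U ^ q = 0)
    (h : (U * V + A * B) * P = 0) : B * (U ^ (q - 1) * V ^ b * A ^ (q - 1 - b) * P) = 0 := by
  obtain ⟨k, rfl⟩ : ∃ k, q = b + 1 + 1 + k := ⟨q - (b + 2), by omega⟩
  have e1 : b + 1 + 1 + k - 1 = b + 1 + k := by omega
  have e2 : b + 1 + 1 + k - 1 - b = k + 1 := by omega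
  rw [e2, e1]
  have h1 : A * B * P = - (U * V * P) := by linear_combination h
  calc _ = U ^ (b + 1 + k) * V ^ b * A ^ k * (A * B * P) := by ring
    _ = - V ^ (b + 1) * A ^ k * P * U ^ (b + 1 + 1 + k) := by rw [h1]; ring
    _ = 0 := by rw [hU]; ring

theorem gs_killY (U V A B x y Q : S) (q b : ℕ) (hb : b + 1 < q) (hU : U ^ q = 0)
    (hA : A ^ q = 0) (hx : x ^ q = 0) (hu : IsUnit ((b + 1 : ℕ) : S))
    (h : (U * V + A * B + x * y) * Q = 0) :
    y * (U ^ (q - 1) * V ^ b * A ^ (q - 1 - b) * (x ^ (q - 1) * Q)) = 0 := by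
  obtain ⟨k, rfl⟩ : ∃ k, q = b + 1 + 1 + k := ⟨q - (b + 2), by omega⟩
  have e1 : b + 1 + 1 + k - 1 = b + 1 + k := by omega
  have e2 : b + 1 + 1 + k - 1 - b = k + 1 := by omega
  rw [e2, e1]
  have h0 : (A * B + (U * V + x * y)) * Q = 0 := by linear_combination h
  have h1 := gs_pow_transfer _ _ _ h0 (b + 1)
  have hs : (-(U * V + x * y)) ^ (b + 1) = (-1) ^ (b + 1) * (U * V + x * y) ^ (b + 1) := by
    rw [← mul_pow]; ring
  have hone : ((-1 : S)) ^ (b + 1) * (-1) ^ (b + 1) = 1 := by rw [← mul_pow]; simp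
  rw [hs] at h1
  have h2 : (U * V + x * y) ^ (b + 1) * Q = (-1) ^ (b + 1) * (A * B) ^ (b + 1) * Q := by
    linear_combination (-(-1 : S) ^ (b + 1)) * h1 - (U * V + x * y) ^ (b + 1) * Q * hone
  obtain ⟨r, hr⟩ := Polynomial.powAddExpansion (U * V) (x * y) (b + 1)
  rw [hr, Nat.add_sub_cancel] at h2
  rw [← hu.mul_right_eq_zero]
  have hU' : U ^ (k + 1) * U ^ (b + 1) = 0 := by rw [← hU]; ring
  have hA' : A ^ (k + 1) * A ^ (b + 1) = 0 := by rw [← hA]; ring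
  have hx' : x ^ (b + k) * x ^ 2 = 0 := by rw [← hx]; ring
  have h3 : U ^ (k + 1) * A ^ (k + 1) * x ^ (b + k) *
      (((U * V) ^ (b + 1) + ((b + 1 : ℕ) : S) * (U * V) ^ b * (x * y) + r * (x * y) ^ 2) * Q)
      = U ^ (k + 1) * A ^ (k + 1) * x ^ (b + k) * ((-1) ^ (b + 1) * (A * B) ^ (b + 1) * Q) := by
    rw [h2]
  rw [mul_pow A B, mul_pow U V (b + 1), mul_pow x y 2, mul_pow U V b] at h3
  have t1 : U ^ (k + 1) * A ^ (k + 1) * x ^ (b + k) * (U ^ (b + 1) * V ^ (b + 1) * Q) = 0 := by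
    linear_combination (A ^ (k + 1) * x ^ (b + k) * V ^ (b + 1) * Q) * hU'
  have t2 : U ^ (k + 1) * A ^ (k + 1) * x ^ (b + k) * (r * (x ^ 2 * y ^ 2) * Q) = 0 := by
    linear_combination (U ^ (k + 1) * A ^ (k + 1) * r * y ^ 2 * Q) * hx'
  have t3 : U ^ (k + 1) * A ^ (k + 1) * x ^ (b + k) *
      ((-1) ^ (b + 1) * (A ^ (b + 1) * B ^ (b + 1)) * Q) = 0 := by
    linear_combination (U ^ (k + 1) * x ^ (b + k) * (-1) ^ (b + 1) * B ^ (b + 1) * Q) * hA'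
  rw [t3] at h3
  have e3 : U ^ (b + 1 + k) = U ^ (k + 1) * U ^ b := by ring
  have e4 : x ^ (b + 1 + k) = x ^ (b + k) * x := by ring
  rw [e3, e4]
  linear_combination h3 - t1 - t2

theorem gs_kill {t : ℕ} (g : Fin t ⊕ Fin t → S) (q b : ℕ) (hb : b < q)
    (hg : ∀ i, g i ^ q = 0) (hf : ∑ i, g (Sum.inl i) * g (Sum.inr i) = 0)
    (hu : IsUnit ((b + 1 : ℕ) : S)) (hq : q = 1 ∨ b + 1 < q)
    (i0 i1 : Fin t) (h01 : i0 ≠ i1) (u v : Fin t ⊕ Fin t)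
    (huv : (u = Sum.inl i0 ∧ v = Sum.inr i0) ∨ (u = Sum.inr i0 ∧ v = Sum.inl i0))
    (i : Fin t ⊕ Fin t) :
    g i * (g u ^ (q - 1) * g v ^ b * g (Sum.inl i1) ^ (q - 1 - b) *
      ∏ j ∈ (Finset.univ.erase i0).erase i1, g (Sum.inl j) ^ (q - 1)) = 0 := by
  rcases hq with rfl | hb1
  · have := hg i
    rw [pow_one] at this
    rw [this, zero_mul]
  have huv' : g u * g v = g (Sum.inl i0) * g (Sum.inr i0) := by
    rcases huv with ⟨rfl, rfl⟩ | ⟨rfl, rfl⟩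
    · rfl
    · ring
  set T : Finset (Fin t) := (Finset.univ.erase i0).erase i1 with hT
  have hx : ∀ j, g (Sum.inl j) * g (Sum.inl j) ^ (q - 1) = 0 := by
    intro j
    rw [← pow_succ', Nat.sub_add_cancel (by omega)]; exact hg _
  have hsplit : g u * g v + g (Sum.inl i1) * g (Sum.inr i1)
      + ∑ j ∈ T, g (Sum.inl j) * g (Sum.inr j) = 0 := by
    rw [← hf, ← Finset.add_sum_erase _ _ (Finset.mem_univ i0),
      ← Finset.add_sum_erase (Finset.univ.erase i0) _
        (Finset.mem_erase.2 ⟨h01.symm, Finset.mem_univ i1⟩), huv']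
    ring
  have hz : ∀ T' : Finset (Fin t), (∑ j ∈ T', g (Sum.inl j) * g (Sum.inr j)) *
      ∏ j ∈ T', g (Sum.inl j) ^ (q - 1) = 0 := by
    intro T'
    rw [Finset.sum_mul]
    refine Finset.sum_eq_zero fun j hj => ?_
    rw [← Finset.mul_prod_erase _ _ hj]
    linear_combination (g (Sum.inr j) * ∏ x ∈ T'.erase j, g (Sum.inl x) ^ (q - 1)) * hx j
  have hP : (g u * g v + g (Sum.inl i1) * g (Sum.inr i1)) *
      ∏ j ∈ T, g (Sum.inl j) ^ (q - 1) = 0 := by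
    linear_combination (∏ j ∈ T, g (Sum.inl j) ^ (q - 1)) * hsplit - hz T
  have hku : g u * (g u ^ (q - 1) * g v ^ b * g (Sum.inl i1) ^ (q - 1 - b) *
      ∏ j ∈ T, g (Sum.inl j) ^ (q - 1)) = 0 := by
    have : g u * g u ^ (q - 1) = 0 := by
      rw [← pow_succ', Nat.sub_add_cancel (by omega)]; exact hg _
    rw [← mul_assoc, ← mul_assoc, ← mul_assoc, this]; simp
  have hkv := gs_killV (g u) (g v) (g (Sum.inl i1)) (g (Sum.inr i1)) _ q b hb1 (hg _) hP
  by_cases hiu : i = u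
  · rw [hiu]; exact hku
  by_cases hiv : i = v
  · rw [hiv]; exact hkv
  have hmem : ∀ j, j ≠ i0 → j ≠ i1 → j ∈ T := by
    intro j h1 h2; simp [hT, h1, h2]
  rcases i with j | j
  · have hj0 : j ≠ i0 := by
      rintro rfl; rcases huv with ⟨rfl, rfl⟩ | ⟨rfl, rfl⟩ <;> simp_all
    by_cases hj1 : j = i1
    · rw [hj1]
      exact gs_killA (g u) (g v) (g (Sum.inl i1)) (g (Sum.inr i1)) _ q b hb1 (hg _) hP
    · rw [← Finset.mul_prod_erase _ _ (hmem j hj0 hj1)]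
      linear_combination (g u ^ (q - 1) * g v ^ b * g (Sum.inl i1) ^ (q - 1 - b) *
        ∏ x ∈ T.erase j, g (Sum.inl x) ^ (q - 1)) * hx j
  · have hj0 : j ≠ i0 := by
      rintro rfl; rcases huv with ⟨rfl, rfl⟩ | ⟨rfl, rfl⟩ <;> simp_all
    by_cases hj1 : j = i1
    · rw [hj1]
      exact gs_killB (g u) (g v) (g (Sum.inl i1)) (g (Sum.inr i1)) _ q b hb1 (hg _) hP
    · rw [← Finset.mul_prod_erase _ _ (hmem j hj0 hj1)]
      refine gs_killY (g u) (g v) (g (Sum.inl i1)) (g (Sum.inr i1)) _ _ _ q b hb1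
        (hg _) (hg _) (hg _) hu ?_
      rw [← Finset.add_sum_erase _ _ (hmem j hj0 hj1)] at hsplit
      linear_combination (∏ x ∈ T.erase j, g (Sum.inl x) ^ (q - 1)) * hsplit - hz (T.erase j)

end kill

/-- Condition describing the support of the dual functional. -/
def gsCond {t : ℕ} (q b : ℕ) (i0 i1 : Fin t) (u v : Fin t ⊕ Fin t)
    (m : Fin t ⊕ Fin t →₀ ℕ) : Prop :=
  m v + m (Sum.inr i1) = b ∧ m u + b + 1 = q + m v ∧
  m (Sum.inl i1) + b + 1 = q + m (Sum.inr i1) ∧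
  ∀ i, i ≠ i0 → i ≠ i1 → m (Sum.inl i) + 1 = q ∧ m (Sum.inr i) = 0

open Classical in
/-- Coefficients of the dual functional. -/
noncomputable def gsCoef (K : Type) [Field K] {t : ℕ} (q b : ℕ) (i0 i1 : Fin t)
    (u v : Fin t ⊕ Fin t) (m : Fin t ⊕ Fin t →₀ ℕ) : K :=
  if gsCond q b i0 i1 u v m then (-1) ^ (m (Sum.inr i1)) else 0

/-- The dual functional. -/
noncomputable def gsFun (K : Type) [Field K] {t : ℕ} (q b : ℕ) (i0 i1 : Fin t)
    (u v : Fin t ⊕ Fin t) : MvPolynomial (Fin t ⊕ Fin t) K →ₗ[K] K :=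
  (basisMonomials (Fin t ⊕ Fin t) K).constr K (gsCoef K q b i0 i1 u v)

theorem gsFun_monomial (K : Type) [Field K] {t : ℕ} (q b : ℕ) (i0 i1 : Fin t)
    (u v : Fin t ⊕ Fin t) (m : Fin t ⊕ Fin t →₀ ℕ) :
    gsFun K q b i0 i1 u v (monomial m 1) = gsCoef K q b i0 i1 u v m := by
  have := (basisMonomials (Fin t ⊕ Fin t) K).constr_basis K (gsCoef K q b i0 i1 u v) m
  rwa [coe_basisMonomials] at this

theorem gs_lin_ext (K : Type) [Field K] {σ : Type} (L : MvPolynomial σ K →ₗ[K] K)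
    (h : ∀ m, L (monomial m 1) = 0) (P : MvPolynomial σ K) : L P = 0 := by
  have : L = 0 := (basisMonomials σ K).ext fun m => by simpa using h m
  rw [this]; rfl

theorem gsFun_pow (K : Type) [Field K] {t : ℕ} (q b : ℕ) (hb : b < q) (i0 i1 : Fin t)
    (u v : Fin t ⊕ Fin t)
    (huv : (u = Sum.inl i0 ∧ v = Sum.inr i0) ∨ (u = Sum.inr i0 ∧ v = Sum.inl i0))
    (i : Fin t ⊕ Fin t) (P : MvPolynomial (Fin t ⊕ Fin t) K) :
    gsFun K q b i0 i1 u v (P * X i ^ q) = 0 := by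
  refine gs_lin_ext K ((gsFun K q b i0 i1 u v).comp (LinearMap.mulRight K (X i ^ q))) ?_ P
  intro m
  rw [LinearMap.comp_apply, LinearMap.mulRight_apply, X_pow_eq_monomial, monomial_mul, one_mul,
    gsFun_monomial, gsCoef, if_neg]
  rintro ⟨h1, h2, h3, h4⟩
  have key : q ≤ (m + Finsupp.single i q) i := by simp
  generalize m + Finsupp.single i q = M at *
  rcases i with j | j
  · by_cases hj0 : j = i0
    · subst hj0; rcases huv with ⟨rfl, rfl⟩ | ⟨rfl, rfl⟩ <;> omega
    by_cases hj1 : j = i1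
    · subst hj1; omega
    have := h4 j hj0 hj1; omega
  · by_cases hj0 : j = i0
    · subst hj0; rcases huv with ⟨rfl, rfl⟩ | ⟨rfl, rfl⟩ <;> omega
    by_cases hj1 : j = i1
    · subst hj1; omega
    have := h4 j hj0 hj1; omega

theorem gsFun_f (K : Type) [Field K] {t : ℕ} (q b : ℕ) (i0 i1 : Fin t) (h01 : i0 ≠ i1)
    (u v : Fin t ⊕ Fin t)
    (huv : (u = Sum.inl i0 ∧ v = Sum.inr i0) ∨ (u = Sum.inr i0 ∧ v = Sum.inl i0))
    (P : MvPolynomial (Fin t ⊕ Fin t) K) :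
    gsFun K q b i0 i1 u v (P * ∑ i : Fin t, X (Sum.inl i) * X (Sum.inr i)) = 0 := by
  suffices hmain : ∀ m, gsFun K q b i0 i1 u v (monomial m 1 *
      ∑ i : Fin t, X (Sum.inl i) * X (Sum.inr i)) = 0 by
    generalize (∑ i : Fin t, X (Sum.inl i) * X (Sum.inr i) :
      MvPolynomial (Fin t ⊕ Fin t) K) = F at hmain ⊢
    exact gs_lin_ext K ((gsFun K q b i0 i1 u v).comp (LinearMap.mulRight K F)) hmain P
  intro m
  have hm : ∀ i : Fin t, (monomial m 1 : MvPolynomial (Fin t ⊕ Fin t) K) *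
      (X (Sum.inl i) * X (Sum.inr i)) =
      monomial (m + Finsupp.single (Sum.inl i) 1 + Finsupp.single (Sum.inr i) 1) 1 := by
    intro i
    simp only [X, monomial_mul, one_mul, add_assoc]
  rw [Finset.mul_sum, map_sum]
  simp_rw [hm, gsFun_monomial]
  rw [← Finset.add_sum_erase _ _ (Finset.mem_univ i0),
      ← Finset.add_sum_erase (Finset.univ.erase i0) _
        (Finset.mem_erase.2 ⟨h01.symm, Finset.mem_univ i1⟩)]
  rw [Finset.sum_eq_zero (s := (Finset.univ.erase i0).erase i1), add_zero]
  · have h10 : i1 ≠ i0 := h01.symm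
    have hiff : gsCond q b i0 i1 u v
          (m + Finsupp.single (Sum.inl i0) 1 + Finsupp.single (Sum.inr i0) 1) ↔
        gsCond q b i0 i1 u v
          (m + Finsupp.single (Sum.inl i1) 1 + Finsupp.single (Sum.inr i1) 1) := by
      unfold gsCond
      refine and_congr ?_ (and_congr ?_ (and_congr ?_ (forall_congr' fun j =>
        forall_congr' fun hj0 => forall_congr' fun hj1 => ?_)))
      · rcases huv with ⟨rfl, rfl⟩ | ⟨rfl, rfl⟩ <;> simp [Finsupp.single_apply, h01, h10] <;> omega
      · rcases huv with ⟨rfl, rfl⟩ | ⟨rfl, rfl⟩ <;> simp [Finsupp.single_apply, h01, h10] <;> omega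
      · simp [Finsupp.single_apply, h01, h10]; try omega
      · simp [Finsupp.single_apply, hj0.symm, hj1.symm]
    unfold gsCoef
    by_cases hc : gsCond q b i0 i1 u v
          (m + Finsupp.single (Sum.inl i0) 1 + Finsupp.single (Sum.inr i0) 1)
    · rw [if_pos hc, if_pos (hiff.1 hc)]
      simp [Finsupp.single_apply, h01, pow_succ]
    · rw [if_neg hc, if_neg (fun h => hc (hiff.2 h)), add_zero]
  · intro j hj
    rw [gsCoef, if_neg]
    rintro ⟨-, -, -, h4⟩
    have := (h4 j (by simp_all) (by simp_all)).2
    simp at this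

/-- Exponent of the socle monomial. -/
noncomputable def gsExp {t : ℕ} (q b : ℕ) (i0 i1 : Fin t) (u v : Fin t ⊕ Fin t) :
    Fin t ⊕ Fin t →₀ ℕ :=
  Finsupp.single u (q - 1) + Finsupp.single v b + Finsupp.single (Sum.inl i1) (q - 1 - b) +
    ∑ j ∈ (Finset.univ.erase i0).erase i1, Finsupp.single (Sum.inl j) (q - 1)

theorem gsExp_apply {t : ℕ} (q b : ℕ) (i0 i1 : Fin t) (h01 : i0 ≠ i1) (u v : Fin t ⊕ Fin t)
    (huv : (u = Sum.inl i0 ∧ v = Sum.inr i0) ∨ (u = Sum.inr i0 ∧ v = Sum.inl i0)) :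
    gsExp q b i0 i1 u v u = q - 1 ∧ gsExp q b i0 i1 u v v = b ∧
    gsExp q b i0 i1 u v (Sum.inl i1) = q - 1 - b ∧ gsExp q b i0 i1 u v (Sum.inr i1) = 0 ∧
    ∀ i, i ≠ i0 → i ≠ i1 → gsExp q b i0 i1 u v (Sum.inl i) = q - 1 ∧
      gsExp q b i0 i1 u v (Sum.inr i) = 0 := by
  have h10 := h01.symm
  unfold gsExp
  generalize q - 1 = r
  rcases huv with ⟨rfl, rfl⟩ | ⟨rfl, rfl⟩ <;>
  · refine ⟨?_, ?_, ?_, ?_, fun i h0 h1 => ⟨?_, ?_⟩⟩ <;>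
    simp_all [Finsupp.finsetSum_apply, Finsupp.single_apply, eq_comm]

theorem gs_monomial_eq (K : Type) [Field K] {t : ℕ} (q b : ℕ) (i0 i1 : Fin t)
    (u v : Fin t ⊕ Fin t) :
    (monomial (gsExp q b i0 i1 u v) 1 : MvPolynomial (Fin t ⊕ Fin t) K) =
    X u ^ (q - 1) * X v ^ b * X (Sum.inl i1) ^ (q - 1 - b) *
      ∏ j ∈ (Finset.univ.erase i0).erase i1, X (Sum.inl j) ^ (q - 1) := by
  simp only [X_pow_eq_monomial, monomial_mul, ← monomial_sum_one, one_mul, gsExp]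

theorem gs_ker (K : Type) [Field K] (t q : ℕ) (L : MvPolynomial (Fin t ⊕ Fin t) K →ₗ[K] K)
    (h1 : ∀ i P, L (P * X i ^ q) = 0)
    (h2 : ∀ P, L (P * ∑ i : Fin t, X (Sum.inl i) * X (Sum.inr i)) = 0)
    (P : MvPolynomial (Fin t ⊕ Fin t) K)
    (hP : (Ideal.Quotient.mk _ (Ideal.Quotient.mk _ P : genHypersurface K t) :
      genFrobPower K t q) = 0) : L P = 0 := by
  rw [Ideal.Quotient.eq_zero_iff_mem, Ideal.mem_span_range_iff_exists_fun] at hP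
  obtain ⟨c, hc⟩ := hP
  choose C hC using fun i => Ideal.Quotient.mk_surjective (c i)
  have h3 : (Ideal.Quotient.mk _ (P - ∑ i, C i * X i ^ q) : genHypersurface K t) = 0 := by
    rw [map_sub, ← hc, map_sum]
    simp [hC]
  rw [Ideal.Quotient.eq_zero_iff_mem, Ideal.mem_span_singleton'] at h3
  obtain ⟨D, hD⟩ := h3
  have : P = D * (∑ i : Fin t, X (Sum.inl i) * X (Sum.inr i)) + ∑ i, C i * X i ^ q := by
    rw [hD]; ring
  rw [this, map_add, h2, map_sum, Finset.sum_eq_zero (fun i _ => h1 i _), add_zero]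

/-- The variable choice. -/
def gsU {t : ℕ} (i0 : Fin t) (s : Bool) : Fin t ⊕ Fin t := if s then Sum.inl i0 else Sum.inr i0

/-- The projection from polynomials, linear over `K`. -/
noncomputable def gsProj (K : Type) [Field K] (t q : ℕ) :
    MvPolynomial (Fin t ⊕ Fin t) K →ₐ[K] genFrobPower K t q :=
  (Ideal.Quotient.mkₐ K _).comp (Ideal.Quotient.mkₐ K _)

/-- Over `R = K[X_1,...,X_t,Y_1,...,Y_t]/(Σ X_iY_i)` with `t ≥ 2` and `q = p^n`, the socle
of `R/m^{[q]}`, i.e. `Hom_R(R/m, R/m^{[q]})`, has `K`-dimension at least `q = p^n`;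
in particular it is unbounded as `n → ∞`. -/
theorem dim_genSocle_ge
    (K : Type) [Field K] (p : ℕ) [CharP K p] (hp : 0 < p)
    (t : ℕ) (ht : 2 ≤ t) (n : ℕ) (q : ℕ) (hq : q = p ^ n) :
    (q : Cardinal) ≤ Module.rank K (genSocle K t q) := by
  have hpp : p.Prime := (CharP.char_is_prime_or_zero K p).resolve_right hp.ne'
  have hq0 : 0 < q := hq ▸ pow_pos hp n
  have hpq : q = 1 ∨ p ∣ q := by
    rcases n with _ | n
    · left; simpa using hq
    · right; rw [hq]; exact dvd_pow_self p (Nat.succ_ne_zero n)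
  let i0 : Fin t := ⟨0, by omega⟩
  let i1 : Fin t := ⟨1, by omega⟩
  have h01 : i0 ≠ i1 := by simp [i0, i1]
  let s : Fin q → Bool := fun j => decide (¬ p ∣ (j : ℕ))
  let b : Fin q → ℕ := fun j => if p ∣ (j : ℕ) then j else j - 1
  let u : Fin q → Fin t ⊕ Fin t := fun j => gsU i0 (s j)
  let v : Fin q → Fin t ⊕ Fin t := fun j => gsU i0 (!s j)
  have huv : ∀ j, (u j = Sum.inl i0 ∧ v j = Sum.inr i0) ∨
      (u j = Sum.inr i0 ∧ v j = Sum.inl i0) := by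
    intro j
    simp only [u, v]
    cases s j <;> simp [gsU]
  have hb : ∀ j, b j < q := by
    intro j
    have := j.2
    simp only [b]; split_ifs <;> omega
  have hbp : ∀ j, ¬ p ∣ b j + 1 := by
    intro j hj
    simp only [b] at hj
    split_ifs at hj with h
    · exact hpp.one_lt.ne' (Nat.dvd_one.1 ((Nat.dvd_add_right h).1 hj))
    · have : (j : ℕ) ≠ 0 := fun h0 => h (h0 ▸ dvd_zero p)
      rw [Nat.sub_add_cancel (by omega)] at hj
      exact h hj
  have hb1 : ∀ j, q = 1 ∨ b j + 1 < q := by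
    intro j
    rcases hpq with h | h
    · exact Or.inl h
    · right
      have h1 := hb j
      rcases Nat.lt_or_ge (b j + 1) q with h2 | h2
      · exact h2
      · exact absurd ((by omega : b j + 1 = q) ▸ h) (hbp j)
  let w : Fin q → MvPolynomial (Fin t ⊕ Fin t) K :=
    fun j => monomial (gsExp q (b j) i0 i1 (u j) (v j)) 1
  have hdual : ∀ j k, gsFun K q (b j) i0 i1 (u j) (v j) (w k) = if j = k then 1 else 0 := by
    intro j k
    simp only [w]
    rw [gsFun_monomial, gsCoef]
    obtain ⟨a1, a2, a3, a4, a5⟩ := gsExp_apply q (b k) i0 i1 h01 (u k) (v k) (huv k)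
    have hbj := hb j
    have hbk := hb k
    by_cases hjk : j = k
    · subst hjk
      rw [if_pos rfl, if_pos, a4, pow_zero]
      refine ⟨by omega, by omega, by omega, fun i h0 h1 => ⟨?_, (a5 i h0 h1).2⟩⟩
      rw [(a5 i h0 h1).1]; omega
    · rw [if_neg hjk, if_neg]
      rintro ⟨c1, c2, -, -⟩
      apply hjk
      have hj2 := j.2
      have hk2 := k.2
      by_cases hs : s j = s k
      · have hv : v j = v k := by simp only [v, hs]
        rw [hv, a2, a4, add_zero] at c1
        have hs' : p ∣ (j : ℕ) ↔ p ∣ (k : ℕ) := by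
          simpa [s, not_iff_not] using hs
        ext
        simp only [b] at c1
        by_cases hd : p ∣ (j : ℕ)
        · rw [if_pos hd, if_pos (hs'.1 hd)] at c1; exact c1.symm
        · have hd' := fun h => hd (hs'.2 h)
          rw [if_neg hd, if_neg hd'] at c1
          have : (j : ℕ) ≠ 0 := fun h0 => hd (h0 ▸ dvd_zero p)
          have : (k : ℕ) ≠ 0 := fun h0 => hd' (h0 ▸ dvd_zero p)
          omega
      · have hs' : s j = !s k := by
          revert hs; cases s j <;> cases s k <;> simp
        have hv : v j = u k := by simp only [v, u, hs', Bool.not_not]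
        have hu : u j = v k := by simp only [v, u, hs']
        rw [hv, a1] at c1 c2
        rw [hu, a2] at c2
        rcases hpq with h | h
        · ext; omega
        · have hq1 : q ≠ 1 := fun h1 => hpp.one_lt.ne' (Nat.dvd_one.1 (h1 ▸ h))
          have := (hb1 j).resolve_left hq1
          omega
  have hmem : ∀ j, gsProj K t q (w j) ∈ genSocle K t q := by
    intro j
    rw [Submodule.mem_iInf]
    intro i
    rw [LinearMap.mem_ker, LinearMap.mulLeft_apply]
    have hX : ∀ i, (Ideal.Quotient.mk _ ((Ideal.Quotient.mk _ (X i) : genHypersurface K t)) :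
        genFrobPower K t q) = gsProj K t q (X i) := fun i => rfl
    rw [hX]
    simp only [w]
    rw [gs_monomial_eq]
    simp only [map_mul, map_pow, map_prod]
    refine gs_kill (fun i => gsProj K t q (X i)) q (b j) (hb j) ?_ ?_ ?_ (hb1 j) i0 i1 h01
      (u j) (v j) (huv j) i
    · intro i
      rw [← hX, ← map_pow, Ideal.Quotient.eq_zero_iff_mem]
      exact Ideal.subset_span ⟨i, rfl⟩
    · have h0 : (Ideal.Quotient.mk _ (∑ i : Fin t, X (Sum.inl i) * X (Sum.inr i)) :
          genHypersurface K t) = 0 := by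
        rw [Ideal.Quotient.eq_zero_iff_mem]
        exact Ideal.subset_span rfl
      have h1 : gsProj K t q (∑ i : Fin t, X (Sum.inl i) * X (Sum.inr i)) = 0 := by
        change Ideal.Quotient.mk _ (Ideal.Quotient.mk _ _) = _
        rw [h0, map_zero]
      simpa only [map_sum, map_mul] using h1
    · have h1 : ((b j + 1 : ℕ) : K) ≠ 0 := by
        rw [Ne, CharP.cast_eq_zero_iff K p]; exact hbp j
      have h2 := ((IsUnit.mk0 _ h1).map
        (C : K →+* MvPolynomial (Fin t ⊕ Fin t) K)).map (gsProj K t q)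
      rwa [map_natCast, map_natCast] at h2
  have hli : LinearIndependent K (fun j => (⟨gsProj K t q (w j), hmem j⟩ : genSocle K t q)) := by
    apply LinearIndependent.of_comp (genSocle K t q).subtype
    rw [linearIndependent_iff']
    intro F c hc j hj
    have h1 : gsProj K t q (∑ k ∈ F, c k • w k) = 0 := by
      rw [← hc, map_sum]
      refine Finset.sum_congr rfl fun k _ => ?_
      rw [map_smul]; rfl
    have h2 := gs_ker K t q (gsFun K q (b j) i0 i1 (u j) (v j))
      (fun i P => gsFun_pow K q (b j) (hb j) i0 i1 _ _ (huv j) i P)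
      (fun P => gsFun_f K q (b j) i0 i1 h01 _ _ (huv j) P) _ h1
    rw [map_sum] at h2
    simp only [map_smul, hdual] at h2
    simpa [hj] using h2
  have := hli.cardinal_le_rank
  simpa using this
end
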